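/- arXiv:2510.12281 — 3 statements merged into one kernel-verified Lean document; each statement's English description precedes it below -/
import Mathlib

section
/- Let 0 < t ≤ 1. If Γ ⊂ ℝ² is a t-quasicircle, then there exist a constant R > 0 and a weakly (R,t)-quasisymmetric mapping f : 𝕋 → ℝ² (a homeomorphism of the unit circle onto its image) such that Γ = f(𝕋). -/
open Metric Set Real

/-- A map `f` between metric spaces is *weakly (R,t)-quasisymmetric* if
`dist a x ≤ dist b x` implies `dist (f a) (f x) ≤ R * dist (f b) (f x) ^ t`. -/
def WeaklyQS {X Y : Type*} [MetricSpace X] [MetricSpace Y] (R t : ℝ) (f : X → Y) : Prop :=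
  ∀ a b x : X, dist a x ≤ dist b x → dist (f a) (f x) ≤ R * dist (f b) (f x) ^ t

/-- A parametrization of a Jordan curve: a continuous `2π`-periodic map which is
injective on a period. -/
def IsJordanParam (p : ℝ → ℂ) : Prop :=
  Continuous p ∧ Function.Periodic p (2 * π) ∧ Set.InjOn p (Set.Ico 0 (2 * π))

/-- A set `Γ ⊆ ℂ` is a Jordan curve if it is the range of some Jordan parametrization. -/
def IsJordanCurve (Γ : Set ℂ) : Prop :=
  ∃ p : ℝ → ℂ, IsJordanParam p ∧ Set.range p = Γ

/-- `A` is a subarc of the Jordan curve `Γ` joining `x` and `y`. -/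
def IsSubarc (Γ : Set ℂ) (x y : ℂ) (A : Set ℂ) : Prop :=
  ∃ p : ℝ → ℂ, IsJordanParam p ∧ Set.range p = Γ ∧
    ∃ a b : ℝ, a ≤ b ∧ b ≤ a + 2 * π ∧ p a = x ∧ p b = y ∧ A = p '' Set.Icc a b

/-- `Γ` satisfies the `t`-quasicircle condition with constant `C`. -/
def TQuasicircleCond (t C : ℝ) (Γ : Set ℂ) : Prop :=
  ∀ x ∈ Γ, ∀ y ∈ Γ, ∃ A : Set ℂ, IsSubarc Γ x y A ∧ Metric.diam A ≤ C * dist x y ^ t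

/-- `Γ` is a `t`-quasicircle. -/
def IsTQuasicircle (t : ℝ) (Γ : Set ℂ) : Prop :=
  IsJordanCurve Γ ∧ ∃ C : ℝ, 1 ≤ C ∧ TQuasicircleCond t C Γ

/-- Abstract properties of the diameter of the subarc `[u, v]` of a `1`-periodic curve. -/
structure IsArcSize (S : ℝ → ℝ → ℝ) : Prop where
  mono : ∀ {u' u v v' : ℝ}, u' ≤ u → u ≤ v → v ≤ v' → S u v ≤ S u' v'
  tri : ∀ {u v w : ℝ}, u ≤ v → v ≤ w → S u w ≤ S u v + S v w
  self : ∀ u, S u u = 0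
  pos : ∀ {u v : ℝ}, u < v → 0 < S u v
  small : ∀ ε > 0, ∃ δ > 0, ∀ u v, u ≤ v → v - u < δ → S u v < ε
  per : ∀ (u v : ℝ) (m : ℤ), S (u + m) (v + m) = S u v

namespace IsArcSize

variable {S : ℝ → ℝ → ℝ} (hS : IsArcSize S)

include hS

lemma continuousOn_right (u : ℝ) : ContinuousOn (fun w => S u w) (Ici u) := by
  rw [Metric.continuousOn_iff]
  intro b hb ε hε
  obtain ⟨δ, hδ, h⟩ := hS.small ε hε
  refine ⟨δ, hδ, fun a ha hab => ?_⟩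
  simp only [mem_Ici] at ha hb
  rw [Real.dist_eq] at *
  rcases le_total a b with hle | hle
  · have h1 := h a b hle (by rw [abs_sub_comm, abs_of_nonneg (by linarith)] at hab; exact hab)
    have h2 := hS.tri ha hle
    have h3 := hS.mono le_rfl ha hle
    rw [abs_lt]; constructor <;> linarith
  · have h1 := h b a hle (by rw [abs_of_nonneg (by linarith)] at hab; exact hab)
    have h2 := hS.tri hb hle
    have h3 := hS.mono le_rfl hb hle
    rw [abs_lt]; constructor <;> linarith

lemma reflect : IsArcSize (fun u v => S (-v) (-u)) where
  mono h1 h2 h3 := hS.mono (by linarith) (by linarith) (by linarith)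
  tri h1 h2 := by
    have := hS.tri (neg_le_neg h2) (neg_le_neg h1)
    linarith
  self u := hS.self _
  pos h := hS.pos (by linarith)
  small ε hε := by
    obtain ⟨δ, hδ, h⟩ := hS.small ε hε
    exact ⟨δ, hδ, fun u v h1 h2 => h _ _ (by linarith) (by linarith)⟩
  per u v m := by
    have := hS.per (-v) (-u) (-m)
    push_cast at this
    simpa only [neg_add] using this

lemma exists_quarter {u v : ℝ} (huv : u < v) : ∃ a, u < a ∧ a < v ∧ S u a = S u v / 4 := by
  have hp := hS.pos huv
  obtain ⟨a, ⟨h1, h2⟩, ha⟩ := intermediate_value_Icc huv.le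
    ((hS.continuousOn_right u).mono Icc_subset_Ici_self)
    (show S u v / 4 ∈ Icc (S u u) (S u v) by
      rw [hS.self]; constructor <;> linarith)
  simp only at ha
  refine ⟨a, h1.lt_of_ne ?_, h2.lt_of_ne ?_, ha⟩
  · rintro rfl
    rw [hS.self] at ha
    linarith
  · rintro rfl
    linarith

lemma exists_split {u v : ℝ} (huv : u < v) :
    ∃ c : ℝ × ℝ, u < c.1 ∧ c.1 < c.2 ∧ c.2 < v ∧ S u c.1 = S u v / 4 ∧ S c.2 v = S u v / 4 := by
  obtain ⟨a, h1, h2, h3⟩ := hS.exists_quarter huv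
  obtain ⟨b, h4, h5, h6⟩ := hS.reflect.exists_quarter (neg_lt_neg huv)
  simp only [neg_neg] at h6
  refine ⟨(a, -b), h1, ?_, by simp only; linarith, h3, h6⟩
  by_contra hlt
  simp only [not_lt] at hlt
  have h7 := hS.tri h1.le h2.le
  have h8 := hS.mono hlt h2.le le_rfl
  have := hS.pos huv
  linarith

/-- The splitting points can be chosen equivariantly under integer translations. -/
lemma exists_equivariant_split : ∃ c : ℝ → ℝ → ℝ × ℝ, (∀ u v, u < v →
    u < (c u v).1 ∧ (c u v).1 < (c u v).2 ∧ (c u v).2 < v ∧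
      S u (c u v).1 = S u v / 4 ∧ S (c u v).2 v = S u v / 4) ∧
    ∀ u v (m : ℤ), (c (u + m) (v + m)).1 = (c u v).1 + m ∧
      (c (u + m) (v + m)).2 = (c u v).2 + m := by
  classical
  have hex : ∀ u v : ℝ, ∃ c : ℝ × ℝ, u < v → u < c.1 ∧ c.1 < c.2 ∧ c.2 < v ∧
      S u c.1 = S u v / 4 ∧ S c.2 v = S u v / 4 := by
    intro u v
    by_cases h : u < v
    · obtain ⟨c, hc⟩ := hS.exists_split h
      exact ⟨c, fun _ => hc⟩
    · exact ⟨0, fun h' => absurd h' h⟩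
  choose c hc using hex
  refine ⟨fun u v => ((c (u - ⌊u⌋) (v - ⌊u⌋)).1 + ⌊u⌋, (c (u - ⌊u⌋) (v - ⌊u⌋)).2 + ⌊u⌋),
    fun u v huv => ?_, fun u v m => ?_⟩
  · obtain ⟨h1, h2, h3, h4, h5⟩ := hc (u - ⌊u⌋) (v - ⌊u⌋) (by linarith)
    refine ⟨by simp only; linarith, by simp only; linarith, by simp only; linarith, ?_, ?_⟩
    · have e1 := hS.per (u - ⌊u⌋) (c (u - ⌊u⌋) (v - ⌊u⌋)).1 ⌊u⌋
      have e2 := hS.per (u - ⌊u⌋) (v - ⌊u⌋) ⌊u⌋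
      rw [sub_add_cancel] at e1 e2
      rw [sub_add_cancel] at e2
      simp only
      rw [e1, h4, e2]
    · have e1 := hS.per (c (u - ⌊u⌋) (v - ⌊u⌋)).2 (v - ⌊u⌋) ⌊u⌋
      have e2 := hS.per (u - ⌊u⌋) (v - ⌊u⌋) ⌊u⌋
      rw [sub_add_cancel] at e1 e2
      rw [sub_add_cancel] at e2
      simp only
      rw [e1, h5, e2]
  · simp only [Int.floor_add_intCast, Int.cast_add]
    have e1 : u + m - ((⌊u⌋ : ℝ) + m) = u - ⌊u⌋ := by ring
    have e2 : v + m - ((⌊u⌋ : ℝ) + m) = v - ⌊u⌋ := by ring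
    rw [e1, e2]
    constructor <;> ring

end IsArcSize

/-- The grid points of the iterated triadic subdivision of `ℝ` with splitting points `c`. -/
noncomputable def triadicGrid (c : ℝ → ℝ → ℝ × ℝ) : ℕ → ℤ → ℝ
  | 0, k => k
  | n + 1, k =>
    if k % 3 = 0 then triadicGrid c n (k / 3)
    else if k % 3 = 1 then (c (triadicGrid c n (k / 3)) (triadicGrid c n (k / 3 + 1))).1
    else (c (triadicGrid c n (k / 3)) (triadicGrid c n (k / 3 + 1))).2

section Grid

variable (c : ℝ → ℝ → ℝ × ℝ)

lemma triadicGrid_zero (k : ℤ) : triadicGrid c 0 k = k := rfl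

lemma triadicGrid_succ_mul (n : ℕ) (k : ℤ) :
    triadicGrid c (n + 1) (3 * k) = triadicGrid c n k := by
  rw [triadicGrid, if_pos (by omega)]
  congr 1
  omega

lemma triadicGrid_succ_one (n : ℕ) (k : ℤ) : triadicGrid c (n + 1) (3 * k + 1) =
    (c (triadicGrid c n k) (triadicGrid c n (k + 1))).1 := by
  rw [triadicGrid, if_neg (by omega), if_pos (by omega)]
  have : (3 * k + 1) / 3 = k := by omega
  rw [this]

lemma triadicGrid_succ_two (n : ℕ) (k : ℤ) : triadicGrid c (n + 1) (3 * k + 2) =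
    (c (triadicGrid c n k) (triadicGrid c n (k + 1))).2 := by
  rw [triadicGrid, if_neg (by omega), if_neg (by omega)]
  have : (3 * k + 2) / 3 = k := by omega
  rw [this]

lemma triadicGrid_add_mul (n m : ℕ) (k : ℤ) :
    triadicGrid c (n + m) (3 ^ m * k) = triadicGrid c n k := by
  induction m with
  | zero => simp
  | succ m ih =>
    rw [← add_assoc, pow_succ', mul_assoc, triadicGrid_succ_mul, ih]

variable {c}

lemma triadicGrid_add_pow (hc : ∀ u v (m : ℤ), (c (u + m) (v + m)).1 = (c u v).1 + m ∧
      (c (u + m) (v + m)).2 = (c u v).2 + m) (n : ℕ) (k : ℤ) :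
    triadicGrid c n (k + 3 ^ n) = triadicGrid c n k + 1 := by
  have hc1 : ∀ u v, (c (u + 1) (v + 1)).1 = (c u v).1 + 1 ∧
      (c (u + 1) (v + 1)).2 = (c u v).2 + 1 := fun u v => by simpa using hc u v 1
  induction n generalizing k with
  | zero => simp [triadicGrid_zero]
  | succ n ih =>
    obtain ⟨j, rfl | rfl | rfl⟩ : ∃ j, k = 3 * j ∨ k = 3 * j + 1 ∨ k = 3 * j + 2 :=
      ⟨k / 3, by omega⟩
    · rw [show 3 * j + 3 ^ (n + 1) = 3 * (j + 3 ^ n) by ring]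
      simp only [triadicGrid_succ_mul, ih]
    · rw [show 3 * j + 1 + 3 ^ (n + 1) = 3 * (j + 3 ^ n) + 1 by ring]
      simp only [triadicGrid_succ_one, ih, show j + 3 ^ n + 1 = j + 1 + 3 ^ n by ring, hc1]
    · rw [show 3 * j + 2 + 3 ^ (n + 1) = 3 * (j + 3 ^ n) + 2 by ring]
      simp only [triadicGrid_succ_two, ih, show j + 3 ^ n + 1 = j + 1 + 3 ^ n by ring, hc1]

variable {S : ℝ → ℝ → ℝ} (hS : IsArcSize S) (hc : ∀ u v, u < v →
    u < (c u v).1 ∧ (c u v).1 < (c u v).2 ∧ (c u v).2 < v ∧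
      S u (c u v).1 = S u v / 4 ∧ S (c u v).2 v = S u v / 4)

include hc

lemma triadicGrid_lt_succ (n : ℕ) (k : ℤ) : triadicGrid c n k < triadicGrid c n (k + 1) := by
  induction n generalizing k with
  | zero => simp [triadicGrid_zero]
  | succ n ih =>
    obtain ⟨j, rfl | rfl | rfl⟩ : ∃ j, k = 3 * j ∨ k = 3 * j + 1 ∨ k = 3 * j + 2 :=
      ⟨k / 3, by omega⟩
    · rw [triadicGrid_succ_mul, triadicGrid_succ_one]
      exact (hc _ _ (ih j)).1
    · rw [triadicGrid_succ_one, show 3 * j + 1 + 1 = 3 * j + 2 by ring, triadicGrid_succ_two]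
      exact (hc _ _ (ih j)).2.1
    · rw [triadicGrid_succ_two, show 3 * j + 2 + 1 = 3 * (j + 1) by ring, triadicGrid_succ_mul]
      exact (hc _ _ (ih j)).2.2.1

lemma triadicGrid_strictMono (n : ℕ) : StrictMono (triadicGrid c n) :=
  strictMono_int_of_lt_succ (triadicGrid_lt_succ hc n)

include hS

lemma triadicGrid_size_children (n : ℕ) (j : ℤ) :
    S (triadicGrid c (n + 1) (3 * j)) (triadicGrid c (n + 1) (3 * j + 1)) =
      S (triadicGrid c n j) (triadicGrid c n (j + 1)) / 4 ∧
    S (triadicGrid c n j) (triadicGrid c n (j + 1)) / 4 ≤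
      S (triadicGrid c (n + 1) (3 * j + 1)) (triadicGrid c (n + 1) (3 * j + 2)) ∧
    S (triadicGrid c (n + 1) (3 * j + 1)) (triadicGrid c (n + 1) (3 * j + 2)) ≤
      S (triadicGrid c n j) (triadicGrid c n (j + 1)) ∧
    S (triadicGrid c (n + 1) (3 * j + 2)) (triadicGrid c (n + 1) (3 * j + 3)) =
      S (triadicGrid c n j) (triadicGrid c n (j + 1)) / 4 := by
  have hlt := triadicGrid_lt_succ hc n j
  obtain ⟨h1, h2, h3, h4, h5⟩ := hc _ _ hlt
  rw [show 3 * j + 3 = 3 * (j + 1) by ring]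
  simp only [triadicGrid_succ_mul, triadicGrid_succ_one, triadicGrid_succ_two]
  have h6 := hS.tri h1.le (h2.le.trans h3.le)
  have h7 := hS.tri h2.le h3.le
  have h8 := hS.pos hlt
  exact ⟨h4, by linarith, hS.mono h1.le h2.le h3.le, h5⟩

lemma triadicGrid_size_adjacent (n : ℕ) (k : ℤ) :
    S (triadicGrid c n k) (triadicGrid c n (k + 1)) ≤
      4 * S (triadicGrid c n (k + 1)) (triadicGrid c n (k + 2)) ∧
    S (triadicGrid c n (k + 1)) (triadicGrid c n (k + 2)) ≤
      4 * S (triadicGrid c n k) (triadicGrid c n (k + 1)) := by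
  induction n generalizing k with
  | zero =>
    have h1 := hS.per k (k + 1) 1
    have h2 := hS.pos (lt_add_one (k : ℝ))
    simp only [triadicGrid_zero]
    push_cast at h1 ⊢
    rw [add_assoc (k : ℝ) 1 1, one_add_one_eq_two] at h1
    constructor <;> linarith
  | succ n ih =>
    obtain ⟨j, rfl | rfl | rfl⟩ : ∃ j, k = 3 * j ∨ k = 3 * j + 1 ∨ k = 3 * j + 2 :=
      ⟨k / 3, by omega⟩
    all_goals
      obtain ⟨h1, h2, h3, h4⟩ := triadicGrid_size_children hS hc n j
      have h5 := hS.pos (triadicGrid_lt_succ hc n j)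
    · constructor <;> linarith
    · rw [show 3 * j + 1 + 1 = 3 * j + 2 by ring, show 3 * j + 1 + 2 = 3 * j + 3 by ring]
      constructor <;> linarith
    · obtain ⟨h6, -, -, -⟩ := triadicGrid_size_children hS hc n (j + 1)
      rw [show 3 * j + 2 + 1 = 3 * j + 3 by ring, show 3 * j + 2 + 2 = 3 * (j + 1) + 1 by ring]
      rw [show 3 * (j + 1) = 3 * j + 3 by ring] at h6 ⊢
      obtain ⟨h7, h8⟩ := ih j
      rw [show j + 2 = j + 1 + 1 by ring] at h7 h8
      constructor <;> linarith

lemma triadicGrid_size_left (n m : ℕ) (k : ℤ) :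
    S (triadicGrid c n (k - m)) (triadicGrid c n k) ≤
      4 ^ (m + 1) * S (triadicGrid c n k) (triadicGrid c n (k + 1)) ∧
    S (triadicGrid c n (k - m)) (triadicGrid c n (k - m + 1)) ≤
      4 ^ m * S (triadicGrid c n k) (triadicGrid c n (k + 1)) := by
  have h0 := hS.pos (triadicGrid_lt_succ hc n k)
  induction m with
  | zero =>
    simp only [Nat.cast_zero, sub_zero, hS.self]
    exact ⟨by positivity, by simp⟩
  | succ m ih =>
    have h1 := (triadicGrid_size_adjacent hS hc n (k - (m + 1 : ℕ))).1
    have h2 := (triadicGrid_strictMono hc n).monotone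
      (show k - (m + 1 : ℕ) ≤ k - m by push_cast; omega)
    have h3 := (triadicGrid_strictMono hc n).monotone (show k - m ≤ k by omega)
    rw [show k - (m + 1 : ℕ) + 1 = k - m by push_cast; ring,
      show k - (m + 1 : ℕ) + 2 = k - m + 1 by push_cast; ring] at *
    have h4 := hS.tri h2 h3
    have h5 : 0 < (4 : ℝ) ^ m := by positivity
    have h6 := mul_pos h5 h0
    rw [pow_succ] at ih
    rw [pow_succ, pow_succ]
    obtain ⟨i1, i2⟩ := ih
    constructor <;> linarith

lemma triadicGrid_size_right (n m : ℕ) (k : ℤ) :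
    S (triadicGrid c n k) (triadicGrid c n (k + m)) ≤
      4 ^ (m + 1) * S (triadicGrid c n (k - 1)) (triadicGrid c n k) ∧
    S (triadicGrid c n (k + m - 1)) (triadicGrid c n (k + m)) ≤
      4 ^ m * S (triadicGrid c n (k - 1)) (triadicGrid c n k) := by
  have h0 := hS.pos (triadicGrid_lt_succ hc n (k - 1))
  rw [sub_add_cancel] at h0
  induction m with
  | zero =>
    simp only [Nat.cast_zero, add_zero, hS.self]
    exact ⟨by positivity, by simp⟩
  | succ m ih =>
    have h1 := (triadicGrid_size_adjacent hS hc n (k + m - 1)).2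
    have h2 := (triadicGrid_strictMono hc n).monotone (show k ≤ k + m by omega)
    have h3 := (triadicGrid_strictMono hc n).monotone
      (show k + m ≤ k + (m + 1 : ℕ) by push_cast; omega)
    rw [show k + m - 1 + 1 = k + m by ring,
      show k + m - 1 + 2 = k + (m + 1 : ℕ) by push_cast; ring] at h1
    rw [show k + (m + 1 : ℕ) - 1 = k + m by push_cast; ring]
    have h4 := hS.tri h2 h3
    have h5 : 0 < (4 : ℝ) ^ m := by positivity
    have h6 := mul_pos h5 h0
    rw [pow_succ] at ih
    rw [pow_succ, pow_succ]
    obtain ⟨i1, i2⟩ := ih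
    constructor <;> linarith

omit hS in
lemma triadicGrid_le_of_le {n m : ℕ} {k l : ℤ} (h : (k : ℝ) * 3 ^ m ≤ l * 3 ^ n) :
    triadicGrid c n k ≤ triadicGrid c m l := by
  rw [← triadicGrid_add_mul c n m k, ← triadicGrid_add_mul c m n l, add_comm m n]
  refine (triadicGrid_strictMono hc (n + m)).monotone ?_
  have h' : k * 3 ^ m ≤ l * 3 ^ n := by exact_mod_cast h
  linarith

lemma triadicGrid_exists_between {α β : ℝ} (hαβ : α < β) :
    ∃ n k, α < triadicGrid c n k ∧ triadicGrid c n k < β := by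
  by_contra! hno
  have hσ := hS.pos hαβ
  obtain ⟨δ, hδ, hsmall⟩ := hS.small (S α β / 4) (by linarith)
  have key : ∀ n : ℕ, ∃ k, triadicGrid c n k ≤ α ∧ β ≤ triadicGrid c n (k + 1) ∧
      triadicGrid c n (k + 1) - triadicGrid c n k ≤ 1 - n * δ := by
    intro n
    induction n with
    | zero =>
      refine ⟨⌊α⌋, Int.floor_le α, hno _ _ ?_, ?_⟩
      · simp [triadicGrid_zero]
      · simp [triadicGrid_zero]
    | succ n ih =>
      obtain ⟨k, h1, h2, h3⟩ := ih
      obtain ⟨s1, s2, s3, s4⟩ := triadicGrid_size_children hS hc n k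
      have m1 := triadicGrid_lt_succ hc (n + 1) (3 * k)
      have m2 := triadicGrid_lt_succ hc (n + 1) (3 * k + 1)
      have m3 := triadicGrid_lt_succ hc (n + 1) (3 * k + 2)
      rw [show 3 * k + 1 + 1 = 3 * k + 2 by ring] at m2
      rw [show 3 * k + 2 + 1 = 3 * k + 3 by ring] at m3
      have hS1 := hS.mono h1 hαβ.le h2
      rw [← triadicGrid_succ_mul c n k] at h1 h3
      rw [← triadicGrid_succ_mul c n (k + 1), show 3 * (k + 1) = 3 * k + 3 by ring] at h2 h3
      have d1 : δ ≤ triadicGrid c (n + 1) (3 * k + 1) - triadicGrid c (n + 1) (3 * k) := by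
        by_contra! hlt
        have := hsmall _ _ m1.le hlt
        linarith
      have d3 : δ ≤ triadicGrid c (n + 1) (3 * k + 3) - triadicGrid c (n + 1) (3 * k + 2) := by
        by_contra! hlt
        have := hsmall _ _ m3.le hlt
        linarith
      push_cast
      rcases le_or_gt (triadicGrid c (n + 1) (3 * k + 1)) α with ha | ha
      · rcases le_or_gt (triadicGrid c (n + 1) (3 * k + 2)) α with hb | hb
        · refine ⟨3 * k + 2, hb, ?_, ?_⟩ <;> rw [show 3 * k + 2 + 1 = 3 * k + 3 by ring]
          · exact h2
          · linarith
        · refine ⟨3 * k + 1, ha, ?_, ?_⟩ <;> rw [show 3 * k + 1 + 1 = 3 * k + 2 by ring]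
          · exact hno _ _ hb
          · linarith
      · exact ⟨3 * k, h1, hno _ _ ha, by linarith⟩
  obtain ⟨n, hn⟩ := exists_nat_gt (1 / δ)
  rw [div_lt_iff₀ hδ] at hn
  obtain ⟨k, -, -, h⟩ := key n
  have := triadicGrid_lt_succ hc n k
  linarith

end Grid

/-- A monotone reparametrization of `ℝ` for which adjacent arcs of equal length have comparable
size. -/
theorem IsArcSize.exists_reparametrization {S : ℝ → ℝ → ℝ} (hS : IsArcSize S) :
    ∃ h : ℝ ≃o ℝ, ∃ K : ℝ, 1 ≤ K ∧ (∀ (x : ℝ) (m : ℤ), h (x + m) = h x + m) ∧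
      ∀ x r, 0 < r → r ≤ 1 → S (h (x - r)) (h x) ≤ K * S (h x) (h (x + r)) ∧
        S (h x) (h (x + r)) ≤ K * S (h (x - r)) (h x) := by
  obtain ⟨c, hc, hper⟩ := hS.exists_equivariant_split
  set g := triadicGrid c
  have hgm : ∀ n, Monotone (g n) := fun n => (triadicGrid_strictMono hc n).monotone
  have hupper : ∀ (x : ℝ) (n m : ℕ) (k : ℤ), x * 3 ^ n ≤ k → g m ⌊x * 3 ^ m⌋ ≤ g n k := by
    intro x n m k hk
    apply triadicGrid_le_of_le hc
    calc (⌊x * 3 ^ m⌋ : ℝ) * 3 ^ n ≤ x * 3 ^ m * 3 ^ n := by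
          gcongr
          exact Int.floor_le _
      _ = x * 3 ^ n * 3 ^ m := by ring
      _ ≤ k * 3 ^ m := by gcongr
  have hbdd : ∀ x : ℝ, BddAbove (range fun n => g n ⌊x * 3 ^ n⌋) := by
    intro x
    refine ⟨g 0 ⌈x⌉, ?_⟩
    rintro _ ⟨m, rfl⟩
    exact hupper x 0 m _ (by simpa using Int.le_ceil x)
  set h : ℝ → ℝ := fun x => ⨆ n, g n ⌊x * 3 ^ n⌋ with hh
  have hle : ∀ (x : ℝ) (n : ℕ) (k : ℤ), x * 3 ^ n ≤ k → h x ≤ g n k := fun x n k hk =>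
    ciSup_le fun m => hupper x n m k hk
  have hge : ∀ (x : ℝ) (n : ℕ) (k : ℤ), k ≤ x * 3 ^ n → g n k ≤ h x := fun x n k hk =>
    (hgm n (Int.le_floor.2 hk)).trans (le_ciSup (hbdd x) n)
  have hpow : ∀ n : ℕ, (0 : ℝ) < 3 ^ n := fun n => by positivity
  have hmono : Monotone h := by
    intro x y hxy
    refine ciSup_mono (hbdd y) fun n => hgm n (Int.floor_mono ?_)
    gcongr
  have hstrict : StrictMono h := by
    intro x y hxy
    obtain ⟨n, hn⟩ := pow_unbounded_of_one_lt (2 / (y - x)) (show (1 : ℝ) < 3 by norm_num)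
    rw [div_lt_iff₀ (by linarith)] at hn
    have h1 := Int.lt_floor_add_one (x * 3 ^ n)
    have h2 := Int.floor_le (x * 3 ^ n)
    calc h x ≤ g n (⌊x * 3 ^ n⌋ + 1) := hle _ _ _ (by push_cast; linarith)
      _ < g n (⌊x * 3 ^ n⌋ + 1 + 1) := triadicGrid_lt_succ hc n _
      _ ≤ h y := hge _ _ _ (by push_cast; nlinarith)
  have hgrid : ∀ (n : ℕ) (k : ℤ), h (k / 3 ^ n) = g n k := by
    intro n k
    have e : (k : ℝ) / 3 ^ n * 3 ^ n = k := div_mul_cancel₀ _ (hpow n).ne'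
    exact le_antisymm (hle _ _ _ e.le) (hge _ _ _ e.ge)
  have hdense : DenseRange h := by
    refine dense_of_exists_between fun a b hab => ?_
    obtain ⟨n, k, h1, h2⟩ := triadicGrid_exists_between hS hc hab
    exact ⟨g n k, ⟨_, hgrid n k⟩, h1, h2⟩
  have hadd_one : ∀ x, h (x + 1) = h x + 1 := by
    intro x
    simp only [hh]
    rw [ciSup_add (hbdd x)]
    congr 1
    ext n
    rw [← triadicGrid_add_pow hper, ← Int.floor_add_intCast]
    congr 2
    push_cast
    ring
  have hadd : ∀ (x : ℝ) (m : ℤ), h (x + m) = h x + m := by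
    intro x m
    induction m with
    | zero => simp
    | succ i ih =>
      push_cast at ih ⊢
      rw [← add_assoc, hadd_one, ih, add_assoc]
    | pred i ih =>
      have := hadd_one (x + ((-i - 1 : ℤ) : ℝ))
      rw [show x + ((-i - 1 : ℤ) : ℝ) + 1 = x + ((-i : ℤ) : ℝ) by push_cast; ring, ih] at this
      push_cast at this ⊢
      linarith
  have hcont : Continuous h := hmono.continuous_of_denseRange hdense
  have hsurj : Function.Surjective h := by
    intro y
    have h1 := hadd 0 ⌊y - h 0⌋
    have h2 := hadd 0 (⌊y - h 0⌋ + 1)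
    have h3 := Int.floor_le (y - h 0)
    have h4 := Int.lt_floor_add_one (y - h 0)
    push_cast at h2
    obtain ⟨x, -, hx⟩ := intermediate_value_Icc
      (show (0 : ℝ) + ⌊y - h 0⌋ ≤ 0 + (⌊y - h 0⌋ + 1) by linarith) hcont.continuousOn
      (show y ∈ Icc _ _ by constructor <;> linarith)
    exact ⟨x, hx⟩
  refine ⟨hstrict.orderIsoOfSurjective h hsurj, 4 ^ 8, by norm_num, hadd, ?_⟩
  intro x r hr hr1
  obtain ⟨n, hn1, hn2⟩ : ∃ n : ℕ, 2 ≤ r * 3 ^ n ∧ r * 3 ^ n ≤ 6 := by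
    obtain ⟨n, h1, h2⟩ := exists_nat_pow_near (show (1 : ℝ) ≤ 2 / r by
      rw [le_div_iff₀ hr]; linarith) (show (1 : ℝ) < 3 by norm_num)
    rw [le_div_iff₀ hr] at h1
    rw [div_lt_iff₀ hr] at h2
    refine ⟨n + 1, by linarith, ?_⟩
    rw [pow_succ]
    linarith
  simp only [StrictMono.coe_orderIsoOfSurjective]
  constructor
  · have h1 := Int.le_ceil (x * 3 ^ n)
    have h2 := Int.ceil_lt_add_one (x * 3 ^ n)
    set k := ⌈x * 3 ^ n⌉
    calc S (h (x - r)) (h x) ≤ S (g n (k - (7 : ℕ))) (g n k) :=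
          hS.mono (hge _ _ _ (by push_cast; linarith)) (hmono (by linarith)) (hle _ _ _ h1)
      _ ≤ 4 ^ 8 * S (g n k) (g n (k + 1)) := (triadicGrid_size_left hS hc n 7 k).1
      _ ≤ 4 ^ 8 * S (h x) (h (x + r)) := by
          gcongr
          exact hS.mono (hle _ _ _ h1) (hgm n (by omega)) (hge _ _ _ (by push_cast; linarith))
  · have h1 := Int.floor_le (x * 3 ^ n)
    have h2 := Int.lt_floor_add_one (x * 3 ^ n)
    set k := ⌊x * 3 ^ n⌋
    calc S (h x) (h (x + r)) ≤ S (g n k) (g n (k + (7 : ℕ))) :=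
          hS.mono (hge _ _ _ h1) (hmono (by linarith)) (hle _ _ _ (by push_cast; linarith))
      _ ≤ 4 ^ 8 * S (g n (k - 1)) (g n k) := (triadicGrid_size_right hS hc n 7 k).1
      _ ≤ 4 ^ 8 * S (h (x - r)) (h x) := by
          gcongr
          exact hS.mono (hle _ _ _ (by push_cast; linarith)) (hgm n (by omega)) (hge _ _ _ h1)

/-- A `1`-periodic parametrization of a Jordan curve. -/
structure IsUnitLoop (q : ℝ → ℂ) : Prop where
  cont : Continuous q
  per : ∀ (x : ℝ) (m : ℤ), q (x + m) = q x
  inj : ∀ x y, q x = q y → ∃ m : ℤ, x = y + m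

namespace IsUnitLoop

variable {q : ℝ → ℂ} (hq : IsUnitLoop q)

include hq

lemma isBounded_image (u v : ℝ) : Bornology.IsBounded (q '' Icc u v) :=
  (isCompact_Icc.image hq.cont).isBounded

lemma image_add_int (u v : ℝ) (m : ℤ) : q '' Icc (u + m) (v + m) = q '' Icc u v := by
  rw [← Set.image_add_const_Icc, image_image]
  simp only [hq.per]

lemma dist_le_diam {u v x y : ℝ} (hx : x ∈ Icc u v) (hy : y ∈ Icc u v) :
    dist (q x) (q y) ≤ diam (q '' Icc u v) :=
  dist_le_diam_of_mem (hq.isBounded_image u v) (mem_image_of_mem q hx) (mem_image_of_mem q hy)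

lemma isArcSize : IsArcSize (fun u v => diam (q '' Icc u v)) where
  mono h1 _ h3 := diam_mono (image_mono (Icc_subset_Icc h1 h3)) (hq.isBounded_image _ _)
  tri {u v w} h1 h2 := by
    rw [← Icc_union_Icc_eq_Icc h1 h2, image_union]
    exact diam_union' ⟨q v, mem_image_of_mem q (right_mem_Icc.2 h1),
      mem_image_of_mem q (left_mem_Icc.2 h2)⟩
  self u := by simp
  pos {u v} h := by
    have h1 : u < min v (u + 1 / 2) := lt_min h (by linarith)
    have h2 : min v (u + 1 / 2) ≤ u + 1 / 2 := min_le_right _ _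
    refine lt_of_lt_of_le (dist_pos.2 fun he => ?_)
      (hq.dist_le_diam (left_mem_Icc.2 h.le) ⟨h1.le, min_le_left v (u + 1 / 2)⟩)
    obtain ⟨m, hm⟩ := hq.inj _ _ he
    have h3 : (m : ℝ) < 0 := by linarith
    have h4 : (-1 : ℝ) < m := by linarith
    norm_cast at h3
    have h5 : -1 < m := by exact_mod_cast h4
    omega
  small ε hε := by
    have huc := isCompact_Icc.uniformContinuousOn_of_continuous
      (hq.cont.continuousOn (s := Icc (0 : ℝ) 2))
    rw [Metric.uniformContinuousOn_iff] at huc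
    obtain ⟨δ, hδ, h⟩ := huc (ε / 2) (by linarith)
    refine ⟨min δ 1, by positivity, fun u v huv hlt => ?_⟩
    have h1 := lt_of_lt_of_le hlt (min_le_left _ _)
    have h2 := lt_of_lt_of_le hlt (min_le_right _ _)
    have h3 := Int.floor_le u
    have h4 := Int.lt_floor_add_one u
    have h5 := hq.image_add_int (u - ⌊u⌋) (v - ⌊u⌋) ⌊u⌋
    rw [sub_add_cancel, sub_add_cancel] at h5
    rw [h5]
    refine lt_of_le_of_lt (diam_le_of_forall_dist_le (by linarith) ?_) (half_lt_self hε)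
    rintro _ ⟨x, ⟨hx1, hx2⟩, rfl⟩ _ ⟨y, ⟨hy1, hy2⟩, rfl⟩
    refine (h x ⟨by linarith, by linarith⟩ y ⟨by linarith, by linarith⟩ ?_).le
    rw [Real.dist_eq, abs_lt]
    constructor <;> linarith
  per u v m := by rw [hq.image_add_int]

/-- A connected subset of a loop containing two points contains one of the two arcs joining
them. -/
lemma arc_subset_of_isPreconnected {A : Set ℂ} (hA : IsPreconnected A) (hAq : A ⊆ range q)
    {x y : ℝ} (hx : q x ∈ A) (hy : q y ∈ A) :
    q '' Icc x y ⊆ A ∨ q '' Icc y (x + 1) ⊆ A := by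
  by_contra! hno
  obtain ⟨h1, h2⟩ := hno
  rw [not_subset] at h1 h2
  obtain ⟨_, ⟨u, ⟨hu1, hu2⟩, rfl⟩, hu⟩ := h1
  obtain ⟨_, ⟨w, ⟨hw1, hw2⟩, rfl⟩, hw⟩ := h2
  have hx1 : q (x + 1) = q x := by simpa using hq.per x 1
  obtain ⟨z, hz, ⟨v, ⟨hv1, hv2⟩, rfl⟩, v', ⟨hv'1, hv'2⟩, hvv⟩ :=
    isPreconnected_closed_iff.1 hA (q '' Icc u w) (q '' Icc w (u + 1))
      (isCompact_Icc.image hq.cont).isClosed (isCompact_Icc.image hq.cont).isClosed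
      (by
        intro z hz
        obtain ⟨s, rfl⟩ := hAq hz
        rw [← image_union]
        have h1 := Int.floor_le (s - u)
        have h2 := Int.lt_floor_add_one (s - u)
        refine ⟨s - ⌊s - u⌋, ?_, ?_⟩
        · rcases le_total (s - ⌊s - u⌋) w with h | h
          · exact Or.inl ⟨by linarith, h⟩
          · exact Or.inr ⟨h, by linarith⟩
        · have := hq.per (s - ⌊s - u⌋) ⌊s - u⌋
          rw [sub_add_cancel] at this
          exact this.symm)
      ⟨q y, hy, mem_image_of_mem q ⟨hu2, hw1⟩⟩
      ⟨q x, hx, x + 1, ⟨hw2, by linarith⟩, hx1⟩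
  obtain ⟨m, hm⟩ := hq.inj _ _ hvv
  have hm0 : (0 : ℝ) ≤ m := by linarith
  have hm1 : (m : ℝ) ≤ 1 := by linarith
  obtain rfl | rfl : m = 0 ∨ m = 1 := by
    have h3 : 0 ≤ m := by exact_mod_cast hm0
    have h4 : m ≤ 1 := by exact_mod_cast hm1
    omega
  · rw [Int.cast_zero, add_zero] at hm
    exact hw (by rwa [show w = v by linarith])
  · rw [Int.cast_one] at hm
    exact hu (by rwa [show u = v by linarith])

lemma comp_orderIso {h : ℝ ≃o ℝ} (hh : ∀ (x : ℝ) (m : ℤ), h (x + m) = h x + m) :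
    IsUnitLoop (q ∘ h) where
  cont := hq.cont.comp h.continuous
  per x m := by simp only [Function.comp_apply, hh, hq.per]
  inj x y hxy := by
    obtain ⟨m, hm⟩ := hq.inj _ _ hxy
    exact ⟨m, h.injective (by rw [hm, hh])⟩

/-- A loop on which adjacent arcs of equal parameter length have comparable diameters satisfies the
weak quasisymmetry inequality whenever its image is a `t`-quasicircle. -/
lemma dist_le_rpow_dist {K t C : ℝ} (hK : 1 ≤ K) (hC : 1 ≤ C)
    (hcomp : ∀ x r, 0 < r → r ≤ 1 →
      diam (q '' Icc (x - r) x) ≤ K * diam (q '' Icc x (x + r)) ∧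
      diam (q '' Icc x (x + r)) ≤ K * diam (q '' Icc (x - r) x))
    (hΓ : TQuasicircleCond t C (range q)) (x α β : ℝ) (hαβ : |α| ≤ |β|) (hβ : |β| ≤ 1 / 2) :
    dist (q (x + α)) (q x) ≤ K ^ 2 * C * dist (q (x + β)) (q x) ^ t := by
  rcases eq_or_ne β 0 with rfl | hβ0
  · have : α = 0 := by simpa using hαβ
    subst this
    simp only [add_zero, dist_self]
    positivity
  have hr : 0 < |β| := abs_pos.2 hβ0
  set r := |β| with hrdef
  obtain ⟨c1, c2⟩ := hcomp x r hr (by linarith)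
  have hα := abs_le.1 hαβ
  have hS := hq.isArcSize
  have hL : dist (q (x + α)) (q x) ≤
      max (diam (q '' Icc (x - r) x)) (diam (q '' Icc x (x + r))) := by
    rcases le_total 0 α with h | h
    · exact le_max_of_le_right
        (hq.dist_le_diam ⟨by linarith, by linarith⟩ ⟨by linarith, by linarith⟩)
    · exact le_max_of_le_left
        (hq.dist_le_diam ⟨by linarith, by linarith⟩ ⟨by linarith, by linarith⟩)
  obtain ⟨A, ⟨p', hp', hrange, a, b, hab, -, hpa, hpb, rfl⟩, hdiam⟩ :=
    hΓ (q x) ⟨x, rfl⟩ (q (x + β)) ⟨x + β, rfl⟩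
  rw [dist_comm (q x)] at hdiam
  set A := p' '' Icc a b
  have hA : IsPreconnected A := isPreconnected_Icc.image _ hp'.1.continuousOn
  have hAq : A ⊆ range q := hrange ▸ image_subset_range _ _
  have hAb : Bornology.IsBounded A := (isCompact_Icc.image hp'.1).isBounded
  have hxA : q x ∈ A := ⟨a, left_mem_Icc.2 hab, hpa⟩
  have hyA : q (x + β) ∈ A := ⟨b, right_mem_Icc.2 hab, hpb⟩
  have hd0 : 0 ≤ diam A := diam_nonneg
  have hd1 : diam A ≤ K * diam A := le_mul_of_one_le_left hd0 hK
  have hboth : diam (q '' Icc (x - r) x) ≤ diam A ∨ diam (q '' Icc x (x + r)) ≤ diam A := by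
    rcases lt_or_gt_of_ne hβ0 with hneg | hpos
    · have e : x + β = x - r := by rw [hrdef, abs_of_neg hneg]; ring
      rw [e] at hyA
      rcases hq.arc_subset_of_isPreconnected hA hAq hyA hxA with h | h
      · exact Or.inl (diam_mono h hAb)
      · exact Or.inr (diam_mono ((image_mono (Icc_subset_Icc le_rfl (by linarith))).trans h) hAb)
    · have e : x + β = x + r := by rw [hrdef, abs_of_pos hpos]
      rw [e] at hyA
      rcases hq.arc_subset_of_isPreconnected hA hAq hxA hyA with h | h
      · exact Or.inr (diam_mono h hAb)
      · left
        have e2 := hq.image_add_int (x - r) x 1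
        rw [Int.cast_one] at e2
        rw [← e2]
        exact diam_mono ((image_mono (Icc_subset_Icc (by linarith) le_rfl)).trans h) hAb
  have hmax : max (diam (q '' Icc (x - r) x)) (diam (q '' Icc x (x + r))) ≤ K * diam A := by
    rcases hboth with h | h
    · exact max_le (h.trans hd1) (c2.trans (by gcongr))
    · exact max_le (c1.trans (by gcongr)) (h.trans hd1)
  calc dist (q (x + α)) (q x) ≤ K * diam A := hL.trans hmax
    _ ≤ K ^ 2 * diam A := by gcongr; nlinarith
    _ ≤ K ^ 2 * (C * dist (q (x + β)) (q x) ^ t) := by gcongr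
    _ = K ^ 2 * C * dist (q (x + β)) (q x) ^ t := by ring

/-- A unit loop factors through the unit circle. -/
lemma exists_circle_map : ∃ f : sphere (0 : ℂ) 1 → ℂ, Continuous f ∧
    ∀ (z : sphere (0 : ℂ) 1) (θ : ℝ), (z : ℂ) = Complex.exp (Complex.I * (2 * π * θ : ℝ)) →
      f z = q θ := by
  have hper : Function.Periodic q 1 := fun x => by simpa using hq.per x 1
  let ι : sphere (0 : ℂ) 1 → Circle := fun z => z
  have hι : Continuous ι := continuous_id
  let e := AddCircle.homeomorphCircle (T := 1) one_ne_zero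
  have hlift : Continuous hper.lift :=
    continuous_coinduced_dom.2 hq.cont
  refine ⟨fun z => hper.lift (e.symm (ι z)), hlift.comp (e.symm.continuous.comp hι), ?_⟩
  intro z θ hz
  have : ι z = e (θ : AddCircle (1 : ℝ)) := by
    rw [AddCircle.homeomorphCircle_apply, AddCircle.toCircle_apply_mk]
    apply Subtype.ext
    change (z : ℂ) = (Circle.exp _ : ℂ)
    rw [hz, Circle.coe_exp]
    congr 1
    push_cast
    ring
  simp only [this, Homeomorph.symm_apply_apply, Function.Periodic.lift_coe]

end IsUnitLoop

lemma IsJordanParam.isUnitLoop {p : ℝ → ℂ} (hp : IsJordanParam p) :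
    IsUnitLoop (fun x => p (2 * π * x)) where
  cont := hp.1.comp (by fun_prop)
  per x m := by
    have := hp.2.1.int_mul m (2 * π * x)
    rw [← this]
    congr 1
    ring
  inj x y hxy := by
    have hfr : ∀ s : ℝ, p (2 * π * s) = p (2 * π * Int.fract s) := by
      intro s
      have := hp.2.1.int_mul ⌊s⌋ (2 * π * Int.fract s)
      rw [← this]
      congr 1
      nth_rw 1 [← Int.floor_add_fract s]
      ring
    have hmem : ∀ s : ℝ, 2 * π * Int.fract s ∈ Ico 0 (2 * π) := fun s =>
      ⟨by have := Int.fract_nonneg s; positivity,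
        by simpa using mul_lt_mul_of_pos_left (Int.fract_lt_one s) two_pi_pos⟩
    have h := hp.2.2 (hmem x) (hmem y) (by rw [← hfr, ← hfr]; exact hxy)
    have h' := mul_left_cancel₀ two_pi_pos.ne' h
    obtain ⟨m, hm⟩ := Int.fract_eq_fract.1 h'
    exact ⟨m, by linarith⟩

lemma norm_exp_sub_exp (θ α : ℝ) : ‖Complex.exp (Complex.I * (2 * π * (θ + α) : ℝ)) -
    Complex.exp (Complex.I * (2 * π * θ : ℝ))‖ = 2 * |sin (π * α)| := by
  have h1 : Complex.exp (Complex.I * (2 * π * (θ + α) : ℝ)) -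
      Complex.exp (Complex.I * (2 * π * θ : ℝ)) =
      Complex.exp (Complex.I * (2 * π * θ : ℝ)) *
        (Complex.exp (Complex.I * (2 * π * α : ℝ)) - 1) := by
    rw [mul_sub, mul_one, ← Complex.exp_add]
    congr 2
    push_cast
    ring
  rw [h1, norm_mul, Complex.norm_exp_I_mul_ofReal_sub_one, Complex.norm_exp_I_mul_ofReal, one_mul,
    Real.norm_eq_abs, abs_mul, abs_two]
  congr 3
  ring

lemma abs_le_abs_of_abs_sin_le {α β : ℝ} (hα : |α| ≤ 1 / 2) (hβ : |β| ≤ 1 / 2)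
    (h : |sin (π * α)| ≤ |sin (π * β)|) : |α| ≤ |β| := by
  by_contra! hlt
  have hπ := pi_pos
  have habs : ∀ γ : ℝ, |γ| ≤ 1 / 2 → |sin (π * γ)| = sin (π * |γ|) := by
    intro γ hγ
    have e : |π * γ| = π * |γ| := by rw [abs_mul, abs_of_pos hπ]
    rw [abs_sin_eq_sin_abs_of_abs_le_pi (by rw [e]; nlinarith), e]
  rw [habs α hα, habs β hβ] at h
  have h0 := abs_nonneg β
  have := sin_lt_sin_of_lt_of_le_pi_div_two (x := π * |β|) (y := π * |α|)
    (by nlinarith) (by nlinarith) (by gcongr)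
  linarith

lemma exists_circle_angle (z : sphere (0 : ℂ) 1) :
    ∃ θ : ℝ, (z : ℂ) = Complex.exp (Complex.I * (2 * π * θ : ℝ)) := by
  refine ⟨Complex.arg z / (2 * π), ?_⟩
  have h := Complex.norm_mul_exp_arg_mul_I (z : ℂ)
  rw [mem_sphere_zero_iff_norm.1 z.2, Complex.ofReal_one, one_mul] at h
  rw [mul_div_cancel₀ _ two_pi_pos.ne', mul_comm, h]

lemma exists_circle_angle_near (z : sphere (0 : ℂ) 1) (θ : ℝ) :
    ∃ α : ℝ, |α| ≤ 1 / 2 ∧ (z : ℂ) = Complex.exp (Complex.I * (2 * π * (θ + α) : ℝ)) := by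
  obtain ⟨φ, hφ⟩ := exists_circle_angle z
  refine ⟨φ - θ - round (φ - θ), abs_sub_round _, ?_⟩
  rw [hφ, Complex.exp_eq_exp_iff_exists_int]
  refine ⟨round (φ - θ), ?_⟩
  push_cast
  ring

/-- If `Γ` is a `t`-quasicircle then there exist `R > 0` and a weakly
`(R,t)`-quasisymmetric homeomorphism `f` of the unit circle onto its image with
`Γ = f(𝕋)`. -/
theorem stmt5 (t : ℝ) (ht : 0 < t) (ht1 : t ≤ 1) (Γ : Set ℂ) (hΓ : IsTQuasicircle t Γ) :
    ∃ R : ℝ, 0 < R ∧ ∃ f : Metric.sphere (0 : ℂ) 1 → ℂ,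
      Continuous f ∧ Function.Injective f ∧ Set.range f = Γ ∧ WeaklyQS R t f := by
  obtain ⟨⟨p, hp, rfl⟩, C, hC, hcond⟩ := hΓ
  have hp1 := hp.isUnitLoop
  obtain ⟨h, K, hK, hadd, hcomp⟩ := hp1.isArcSize.exists_reparametrization
  have hq := hp1.comp_orderIso hadd
  have himage : ∀ u v, (fun x => p (2 * π * x)) '' Icc (h u) (h v) =
      ((fun x => p (2 * π * x)) ∘ h) '' Icc u v := fun u v => by
    rw [image_comp, h.image_Icc]
  simp only [himage] at hcomp
  have hrange : range ((fun x => p (2 * π * x)) ∘ h) = range p := by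
    rw [h.surjective.range_comp]
    exact (mul_left_surjective₀ two_pi_pos.ne').range_comp p
  set q := (fun x => p (2 * π * x)) ∘ h
  rw [← hrange] at hcond ⊢
  obtain ⟨f, hf, hfq⟩ := hq.exists_circle_map
  refine ⟨K ^ 2 * C, by positivity, f, hf, ?_, ?_, ?_⟩
  · intro z w hzw
    obtain ⟨θ, hθ⟩ := exists_circle_angle z
    obtain ⟨φ, hφ⟩ := exists_circle_angle w
    rw [hfq z θ hθ, hfq w φ hφ] at hzw
    obtain ⟨m, rfl⟩ := hq.inj _ _ hzw
    apply Subtype.ext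
    rw [hθ, hφ, Complex.exp_eq_exp_iff_exists_int]
    refine ⟨m, ?_⟩
    push_cast
    ring
  · apply Subset.antisymm
    · rintro _ ⟨z, rfl⟩
      obtain ⟨θ, hθ⟩ := exists_circle_angle z
      exact ⟨θ, (hfq z θ hθ).symm⟩
    · rintro _ ⟨θ, rfl⟩
      exact ⟨⟨Complex.exp (Complex.I * (2 * π * θ : ℝ)),
        mem_sphere_zero_iff_norm.2 (Complex.norm_exp_I_mul_ofReal _)⟩, hfq _ θ rfl⟩
  · intro a b x hab
    obtain ⟨θ, hθ⟩ := exists_circle_angle x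
    obtain ⟨α, hα, ha⟩ := exists_circle_angle_near a θ
    obtain ⟨β, hβ, hb⟩ := exists_circle_angle_near b θ
    rw [hfq a _ ha, hfq b _ hb, hfq x _ hθ]
    refine hq.dist_le_rpow_dist hK hC hcomp hcond θ α β
      (abs_le_abs_of_abs_sin_le hα hβ ?_) hβ
    rw [Subtype.dist_eq, Subtype.dist_eq, dist_eq_norm, dist_eq_norm, ha, hb, hθ,
      norm_exp_sub_exp, norm_exp_sub_exp] at hab
    linarith
end

section
/- Let 0 < t ≤ 1 and let Ω be a t-quasidisk. Then there exists a constant N ≥ 1 (depending only on t, the t-quasicircle constant C of ∂Ω, and diam Ω) such that any two points w₁, w₂ ∈ Ω can be joined by a curve γ ⊂ Ω with diam γ ≤ N·|w₁ − w₂|^t. -/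
open Metric Set Real

/-- `Ω` is the `t`-quasidisk bounded by the `t`-quasicircle `Γ` with constant `C`:
the bounded connected component of the complement of `Γ`. -/
def IsTQuasidiskWith (t C : ℝ) (Γ Ω : Set ℂ) : Prop :=
  IsJordanCurve Γ ∧ 1 ≤ C ∧ TQuasicircleCond t C Γ ∧ Bornology.IsBounded Ω ∧
    ∃ x ∈ Γᶜ, Ω = connectedComponentIn Γᶜ x

/-- `(z - a) / (z - b)` has a continuous logarithm on `X`. -/
def HasLogQuotient (X : Set ℂ) (a b : ℂ) : Prop :=
  ∃ f : ℂ → ℂ, ContinuousOn f X ∧ ∀ z ∈ X, Complex.exp (f z) * (z - b) = z - a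

/-- Two continuous logarithms on a preconnected set which agree at a point are equal. -/
theorem eqOn_of_exp_eqOn {A : Type*} [TopologicalSpace A] {S : Set A} (hS : IsPreconnected S)
    {f g : A → ℂ} (hf : ContinuousOn f S) (hg : ContinuousOn g S)
    (h : ∀ z ∈ S, Complex.exp (f z) = Complex.exp (g z)) {y : A} (hy : y ∈ S) (hfg : f y = g y) :
    EqOn f g S :=
  Complex.isCoveringMap_exp.eqOn_of_comp_eqOn hS hf hg (fun z hz => Subtype.ext (h z hz)) hy hfg

theorem HasLogQuotient.symm {X : Set ℂ} {a b : ℂ} (h : HasLogQuotient X a b) :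
    HasLogQuotient X b a := by
  obtain ⟨f, hf, h⟩ := h
  refine ⟨fun z => -f z, hf.neg, fun z hz => ?_⟩
  rw [← h z hz, ← mul_assoc, ← Complex.exp_add]
  simp

theorem HasLogQuotient.trans {X : Set ℂ} {a b c : ℂ} (h : HasLogQuotient X a b)
    (h' : HasLogQuotient X b c) : HasLogQuotient X a c := by
  obtain ⟨f, hf, h⟩ := h
  obtain ⟨g, hg, h'⟩ := h'
  refine ⟨fun z => f z + g z, hf.add hg, fun z hz => ?_⟩
  rw [Complex.exp_add, mul_assoc, h' z hz, h z hz]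

/-- If the ball of radius `2 * dist a b` around `a` misses `X`, the logarithm exists. -/
theorem hasLogQuotient_of_dist {X : Set ℂ} {a b : ℂ} (h : ∀ z ∈ X, 2 * dist a b < dist z a) :
    HasLogQuotient X a b := by
  have key : ∀ z ∈ X, z - b ≠ 0 ∧ (z - a) / (z - b) ∈ Complex.slitPlane := by
    intro z hz
    have h1 := h z hz
    have h2 : dist z a ≤ dist z b + dist a b := by
      rw [dist_comm a b]; exact dist_triangle _ _ _
    have h3 : dist a b < dist z b := by linarith
    have h4 : 0 < dist z b := dist_nonneg.trans_lt h3
    have h5 : z - b ≠ 0 := sub_ne_zero.2 (dist_pos.1 h4)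
    refine ⟨h5, ?_⟩
    have h6 : (z - a) / (z - b) = 1 + (b - a) / (z - b) := by
      field_simp
      ring
    rw [h6]
    apply Complex.mem_slitPlane_of_norm_lt_one
    rw [norm_div, div_lt_one (norm_pos_iff.2 h5), ← dist_eq_norm, ← dist_eq_norm, dist_comm b a]
    exact h3
  refine ⟨fun z => Complex.log ((z - a) / (z - b)), ?_, fun z hz => ?_⟩
  · refine ContinuousOn.clog (ContinuousOn.div (by fun_prop) (by fun_prop)
      fun z hz => (key z hz).1) fun z hz => (key z hz).2
  · rw [Complex.exp_log (Complex.slitPlane_ne_zero (key z hz).2), div_mul_cancel₀ _ (key z hz).1]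

/-- Points in the same complementary component of `X` give a logarithm on `X`. -/
theorem hasLogQuotient_of_isPreconnected {X S : Set ℂ} (hX : IsClosed X) (hS : IsPreconnected S)
    (hSX : S ⊆ Xᶜ) {a b : ℂ} (ha : a ∈ S) (hb : b ∈ S) : HasLogQuotient X a b := by
  refine hS.induction₂ (HasLogQuotient X) (fun x hx => ?_) (fun _ _ _ _ _ _ h h' => h.trans h')
    (fun _ _ _ _ h => h.symm) ha hb
  apply mem_nhdsWithin_of_mem_nhds
  obtain ⟨ε, hε, hball⟩ := Metric.isOpen_iff.1 hX.isOpen_compl x (hSX hx)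
  filter_upwards [Metric.ball_mem_nhds x (half_pos hε)] with y hy
  refine hasLogQuotient_of_dist fun z hz => ?_
  have h1 : ε ≤ dist z x := by
    by_contra! hlt
    exact hball (Metric.mem_ball.2 hlt) hz
  rw [Metric.mem_ball, dist_comm] at hy
  linarith

theorem frontier_connectedComponentIn_subset {X : Set ℂ} (hX : IsClosed X) (a : ℂ) :
    frontier (connectedComponentIn Xᶜ a) ⊆ X := by
  intro z hz
  by_contra hzX
  have hV := connectedComponentIn_mem_nhds (hX.isOpen_compl.mem_nhds hzX)
  obtain ⟨w, hwV, hwU⟩ := mem_closure_iff_nhds.1 hz.1 _ hV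
  have hU := hX.isOpen_compl.connectedComponentIn (x := a)
  rw [frontier, hU.interior_eq] at hz
  apply hz.2
  rw [connectedComponentIn_eq hwU, ← connectedComponentIn_eq hwV]
  exact mem_connectedComponentIn hzX

theorem exists_continuous_log {g : ℂ → ℂ} (hg : Continuous g) (h0 : ∀ z, g z ≠ 0) :
    ∃ h : ℂ → ℂ, Continuous h ∧ ∀ z, Complex.exp (h z) = g z := by
  obtain ⟨F, ⟨-, hF⟩, -⟩ := Complex.isCoveringMapOn_exp.existsUnique_continuousMap_lifts
    ⟨g, hg⟩ (a₀ := 0) (Complex.exp_log (h0 0)) h0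
  exact ⟨F, F.continuous, fun z => congrFun hF z⟩

/-- The function `z - a` has no continuous logarithm on a circle around `a`. -/
theorem not_exists_log_on_circle (a : ℂ) {r : ℝ} (hr : 0 < r) {h : ℂ → ℂ} (hh : Continuous h)
    (he : ∀ z ∈ sphere a r, Complex.exp (h z) = z - a) : False := by
  have hcirc : ∀ θ : ℝ, Complex.exp (h (circleMap a r θ)) = r * Complex.exp (θ * Complex.I) := by
    intro θ
    rw [he _ (circleMap_mem_sphere a hr.le θ), circleMap]
    ring
  have key := eqOn_of_exp_eqOn (isPreconnected_univ (α := ℝ))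
    (f := fun θ => h (circleMap a r θ)) (g := fun θ : ℝ => h (circleMap a r 0) + θ * Complex.I)
    (by fun_prop) (by fun_prop)
    (fun θ _ => by
      rw [Complex.exp_add, hcirc, hcirc]
      simp) (mem_univ 0) (by simp)
  have h2 := key (mem_univ (2 * π))
  have h3 : circleMap a r (2 * π) = circleMap a r 0 := by
    simpa using periodic_circleMap a r 0
  simp [h3, Real.pi_ne_zero] at h2

/-- If the complementary component of `a` is bounded and does not contain `b`, then
there is no logarithm of `(z - a) / (z - b)` on `X`. -/
theorem mem_connectedComponentIn_of_hasLogQuotient {X : Set ℂ} (hX : IsClosed X) {a b : ℂ}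
    (ha : a ∉ X) (hbd : Bornology.IsBounded (connectedComponentIn Xᶜ a))
    (h : HasLogQuotient X a b) : b ∈ connectedComponentIn Xᶜ a := by
  classical
  by_contra hbU
  set U := connectedComponentIn Xᶜ a with hU
  have haU : a ∈ U := mem_connectedComponentIn ha
  obtain ⟨f, hf, hfe⟩ := h
  obtain ⟨F, hF⟩ := ContinuousMap.exists_restrict_eq hX
    ⟨X.domRestrict f, continuousOn_iff_continuous_domRestrict.1 hf⟩
  have hFf : ∀ z ∈ X, F z = f z := fun z hz => congr($hF ⟨z, hz⟩)
  let g : ℂ → ℂ := fun z => if z ∈ U then Complex.exp (F z) * (z - b) else z - a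
  have hg : Continuous g := by
    refine Continuous.if (fun z hz => ?_) (by fun_prop) (by fun_prop)
    have hz' : z ∈ X := frontier_connectedComponentIn_subset hX a hz
    rw [hFf z hz', hfe z hz']
  have hg0 : ∀ z, g z ≠ 0 := by
    intro z
    by_cases hz : z ∈ U
    · simp only [g, if_pos hz]
      exact mul_ne_zero (Complex.exp_ne_zero _) (sub_ne_zero.2 fun e => hbU (e ▸ hz))
    · simp only [g, if_neg hz]
      exact sub_ne_zero.2 fun e => hz (e ▸ haU)
  obtain ⟨L, hL, hLe⟩ := exists_continuous_log hg hg0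
  obtain ⟨r, hr, hUr⟩ := hbd.subset_ball_lt 0 a
  refine not_exists_log_on_circle a hr hL fun z hz => ?_
  have hzU : z ∉ U := fun hzU => (Metric.mem_ball.1 (hUr hzU)).ne hz
  rw [hLe]
  simp [g, hzU]

/-- Logarithms on two closed sets with preconnected intersection can be glued. -/
theorem HasLogQuotient.union {X Y : Set ℂ} (hX : IsClosed X) (hY : IsClosed Y)
    (hXY : IsPreconnected (X ∩ Y)) {a b : ℂ} (hb : b ∉ X ∩ Y) (h : HasLogQuotient X a b)
    (h' : HasLogQuotient Y a b) : HasLogQuotient (X ∪ Y) a b := by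
  classical
  obtain ⟨f, hf, hfe⟩ := h
  obtain ⟨g, hg, hge⟩ := h'
  obtain ⟨c, hc, hfg⟩ : ∃ c : ℂ, Complex.exp c = 1 ∧ EqOn f (fun z => g z + c) (X ∩ Y) := by
    rcases (X ∩ Y).eq_empty_or_nonempty with he | ⟨y, hy⟩
    · exact ⟨0, by simp, by simp [he]⟩
    · have hexp : ∀ z ∈ X ∩ Y, Complex.exp (f z) = Complex.exp (g z) := fun z hz =>
        mul_right_cancel₀ (sub_ne_zero.2 (ne_of_mem_of_not_mem hz hb))
          ((hfe z hz.1).trans (hge z hz.2).symm)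
      have hc : Complex.exp (f y - g y) = 1 := by
        rw [Complex.exp_sub, hexp y hy, div_self (Complex.exp_ne_zero _)]
      refine ⟨f y - g y, hc, eqOn_of_exp_eqOn hXY (hf.mono inter_subset_left)
        ((hg.mono inter_subset_right).add continuousOn_const) (fun z hz => ?_) hy (by simp)⟩
      rw [Complex.exp_add, hc, mul_one, hexp z hz]
  have h1 : EqOn (fun z => if z ∈ X then f z else g z + c) f X := fun z hz => if_pos hz
  have h2 : EqOn (fun z => if z ∈ X then f z else g z + c) (fun z => g z + c) Y := by
    intro z hz
    by_cases hzX : z ∈ X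
    · simpa [hzX] using hfg ⟨hzX, hz⟩
    · simp [hzX]
  refine ⟨fun z => if z ∈ X then f z else g z + c, ContinuousOn.union_of_isClosed
    (hf.congr h1) ((hg.add continuousOn_const).congr h2) hX hY, ?_⟩
  rintro z (hz | hz)
  · rw [h1 hz, hfe z hz]
  · rw [h2 hz, Complex.exp_add, hc, mul_one, hge z hz]

/-- Janiszewski's theorem, for a bounded complementary component. -/
theorem mem_connectedComponentIn_compl_union {X Y : Set ℂ} (hX : IsClosed X) (hY : IsClosed Y)
    (hXY : IsPreconnected (X ∩ Y)) {a b : ℂ}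
    (hbd : Bornology.IsBounded (connectedComponentIn (X ∪ Y)ᶜ a))
    (hbX : b ∈ connectedComponentIn Xᶜ a) (hbY : b ∈ connectedComponentIn Yᶜ a) :
    b ∈ connectedComponentIn (X ∪ Y)ᶜ a := by
  have haX : a ∈ Xᶜ := connectedComponentIn_nonempty_iff.1 ⟨b, hbX⟩
  have haY : a ∈ Yᶜ := connectedComponentIn_nonempty_iff.1 ⟨b, hbY⟩
  refine mem_connectedComponentIn_of_hasLogQuotient (hX.union hY) (fun h => h.elim haX haY) hbd ?_
  refine HasLogQuotient.union hX hY hXY (fun h => connectedComponentIn_subset _ _ hbX h.1) ?_ ?_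
  · exact hasLogQuotient_of_isPreconnected hX isPreconnected_connectedComponentIn
      (connectedComponentIn_subset _ _) (mem_connectedComponentIn haX) hbX
  · exact hasLogQuotient_of_isPreconnected hY isPreconnected_connectedComponentIn
      (connectedComponentIn_subset _ _) (mem_connectedComponentIn haY) hbY

theorem IsJordanParam.comp_add_right {p : ℝ → ℂ} (hp : IsJordanParam p) (c : ℝ) :
    IsJordanParam fun s => p (s + c) := by
  obtain ⟨hc, hper, hinj⟩ := hp
  refine ⟨by fun_prop, hper.add_const c, fun x hx y hy hxy => ?_⟩
  have hmod : ∀ z, p (toIcoMod Real.two_pi_pos 0 z) = p z := fun z => by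
    rw [toIcoMod, hper.sub_zsmul_eq]
  have hmem : ∀ z, toIcoMod Real.two_pi_pos 0 z ∈ Ico 0 (2 * π) := fun z => by
    simpa using toIcoMod_mem_Ico Real.two_pi_pos 0 z
  have h1 := hinj (hmem (x + c)) (hmem (y + c)) (by rw [hmod, hmod]; exact hxy)
  obtain ⟨n, hn⟩ := (toIcoMod_eq_toIcoMod _).1 h1
  have hn0 : n = 0 := by
    rw [zsmul_eq_mul] at hn
    have h2 : (n : ℝ) * (2 * π) < 1 * (2 * π) := by linarith [hx.1, hx.2, hy.1, hy.2]
    have h3 : (-1 : ℝ) * (2 * π) < n * (2 * π) := by linarith [hx.1, hx.2, hy.1, hy.2]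
    have h4 := lt_of_mul_lt_mul_right h2 Real.two_pi_pos.le
    have h5 := lt_of_mul_lt_mul_right h3 Real.two_pi_pos.le
    have h6 : n < 1 := by exact_mod_cast h4
    have h7 : -1 < n := by exact_mod_cast h5
    omega
  rw [hn0] at hn
  simp at hn
  linarith

theorem IsJordanParam.image_Icc {p : ℝ → ℂ} (hp : IsJordanParam p) :
    p '' Icc 0 (2 * π) = range p := by
  simpa using hp.2.1.image_Icc Real.two_pi_pos 0

/-- A preconnected subset of a Jordan curve containing points on both sides of a pair of
parameters `s`, `s'` contains one of the points `p s`, `p s'`. -/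
theorem IsJordanParam.mem_or_mem_of_isPreconnected {p : ℝ → ℂ} (hp : IsJordanParam p)
    {A : Set ℂ} (hA : IsPreconnected A) (hAp : A ⊆ range p) {s s' u : ℝ} (hs : 0 < s)
    (hs' : s' < 2 * π) (hu : u ∈ Icc s s') (h0 : p 0 ∈ A) (hpu : p u ∈ A) :
    p s ∈ A ∨ p s' ∈ A := by
  have hcpt : ∀ a b, IsClosed (p '' Icc a b) := fun a b =>
    (isCompact_Icc.image hp.1).isClosed
  obtain ⟨z, hzA, ⟨v, hv, rfl⟩, hz⟩ := isPreconnected_closed_iff.1 hA (p '' Icc s s')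
    (p '' Icc 0 s ∪ p '' Icc s' (2 * π)) (hcpt _ _) ((hcpt _ _).union (hcpt _ _))
    (by
      intro z hz
      have hz' := hAp hz
      rw [← hp.image_Icc] at hz'
      obtain ⟨v, hv, rfl⟩ := hz'
      rcases le_total v s with h1 | h1
      · exact Or.inr (Or.inl ⟨v, ⟨hv.1, h1⟩, rfl⟩)
      · rcases le_total v s' with h2 | h2
        · exact Or.inl ⟨v, ⟨h1, h2⟩, rfl⟩
        · exact Or.inr (Or.inr ⟨v, ⟨h2, hv.2⟩, rfl⟩))
    ⟨p u, hpu, u, hu, rfl⟩ ⟨p 0, h0, Or.inl ⟨0, ⟨le_rfl, hs.le⟩, rfl⟩⟩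
  have hvI : v ∈ Ico 0 (2 * π) := ⟨hs.le.trans hv.1, hv.2.trans_lt hs'⟩
  rcases hz with ⟨w, hw, hwv⟩ | ⟨w, hw, hwv⟩
  · have hwv' := hp.2.2 ⟨hw.1, by linarith [hw.2, hu.1, hu.2]⟩ hvI hwv
    left
    rwa [show s = v by linarith [hw.2, hv.1]]
  · rcases hw.2.eq_or_lt with h2 | h2
    · have h3 : p 0 = p v := by
        rw [← hwv, h2]
        simpa using (hp.2.1 0).symm
      have h4 := hp.2.2 ⟨le_rfl, Real.two_pi_pos⟩ hvI h3
      linarith [hv.1]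
    · have hwv' := hp.2.2 ⟨by linarith [hw.1, hu.1, hu.2], h2⟩ hvI hwv
      right
      rwa [show s' = v by linarith [hw.1, hv.2]]

theorem IsSubarc.isPreconnected {Γ A : Set ℂ} {x y : ℂ} (h : IsSubarc Γ x y A) :
    IsPreconnected A := by
  obtain ⟨p, hp, -, a, b, -, -, -, -, rfl⟩ := h
  exact isPreconnected_Icc.image p hp.1.continuousOn

theorem IsSubarc.isBounded {Γ A : Set ℂ} {x y : ℂ} (h : IsSubarc Γ x y A) :
    Bornology.IsBounded A := by
  obtain ⟨p, hp, -, a, b, -, -, -, -, rfl⟩ := h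
  exact (isCompact_Icc.image hp.1).isBounded

theorem IsSubarc.subset {Γ A : Set ℂ} {x y : ℂ} (h : IsSubarc Γ x y A) : A ⊆ Γ := by
  obtain ⟨p, -, hpΓ, a, b, -, -, -, -, rfl⟩ := h
  exact hpΓ ▸ image_subset_range _ _

theorem IsSubarc.left_mem {Γ A : Set ℂ} {x y : ℂ} (h : IsSubarc Γ x y A) : x ∈ A := by
  obtain ⟨p, -, -, a, b, hab, -, rfl, -, rfl⟩ := h
  exact mem_image_of_mem p ⟨le_rfl, hab⟩

theorem IsSubarc.right_mem {Γ A : Set ℂ} {x y : ℂ} (h : IsSubarc Γ x y A) : y ∈ A := by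
  obtain ⟨p, -, -, a, b, hab, -, -, rfl, rfl⟩ := h
  exact mem_image_of_mem p ⟨hab, le_rfl⟩

theorem IsJordanCurve.isCompact {Γ : Set ℂ} (h : IsJordanCurve Γ) : IsCompact Γ := by
  obtain ⟨p, hp, rfl⟩ := h
  rw [← hp.image_Icc]
  exact isCompact_Icc.image hp.1

/-- For a set `S` of diameter at most `d` in a ball of large radius, the part of a `t`-quasicircle
on the boundary of the ball is contained in a single compact connected subset of the curve
that avoids `S`. -/
theorem TQuasicircleCond.exists_isPreconnected_disjoint {t C d R : ℝ} {Γ S : Set ℂ} {w : ℂ}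
    (ht : 0 ≤ t) (hC : 0 ≤ C) (hΓ : IsJordanCurve Γ) (hq : TQuasicircleCond t C Γ)
    (hS : ∀ x ∈ S, ∀ y ∈ S, dist x y ≤ d) (hSw : ∀ x ∈ S, dist x w ≤ d)
    (hSΓ : (S ∩ Γ).Nonempty) (hR : d + C * d ^ t < R) :
    ∃ Γ₁ ⊆ Γ, IsClosed Γ₁ ∧ IsPreconnected Γ₁ ∧ Disjoint S Γ₁ ∧ Γ ∩ sphere w R ⊆ Γ₁ := by
  obtain ⟨x₀, hx₀S, hx₀Γ⟩ := hSΓ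
  have hd : 0 ≤ d := dist_nonneg.trans (hSw x₀ hx₀S)
  have hdR : d < R := by
    have := mul_nonneg hC (Real.rpow_nonneg hd t)
    linarith
  obtain ⟨p, hp, hp0, hpΓ⟩ : ∃ p, IsJordanParam p ∧ p 0 = x₀ ∧ range p = Γ := by
    obtain ⟨q, hq, hqΓ⟩ := hΓ
    rw [← hqΓ] at hx₀Γ
    obtain ⟨c, rfl⟩ := hx₀Γ
    refine ⟨_, hq.comp_add_right c, by simp, ?_⟩
    rw [← hqΓ]
    exact (Equiv.addRight c).surjective.range_comp q
  rcases (Γ ∩ sphere w R).eq_empty_or_nonempty with he | ⟨y, hyΓ, hyR⟩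
  · exact ⟨∅, empty_subset _, isClosed_empty, isPreconnected_empty, by simp, he.le⟩
  have hp2 : p (2 * π) = x₀ := by
    rw [← hp0]
    simpa using hp.2.1 0
  have hx₀R : x₀ ∉ sphere w R := fun h => by
    have := hSw x₀ hx₀S
    rw [mem_sphere.1 h] at this
    linarith
  let T : Set ℝ := Icc 0 (2 * π) ∩ p ⁻¹' sphere w R
  have hTc : IsCompact T := isCompact_Icc.inter_right (isClosed_sphere.preimage hp.1)
  have hTne : T.Nonempty := by
    rw [← hpΓ, ← hp.image_Icc] at hyΓ
    obtain ⟨v, hv, rfl⟩ := hyΓ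
    exact ⟨v, hv, hyR⟩
  obtain ⟨s, hsT, hs⟩ := hTc.exists_isLeast hTne
  obtain ⟨s', hsT', hs'⟩ := hTc.exists_isGreatest hTne
  have hs0 : 0 < s := hsT.1.1.lt_of_ne fun h => hx₀R (by rw [← hp0, h]; exact hsT.2)
  have hs2 : s' < 2 * π := hsT'.1.2.lt_of_ne fun h => hx₀R (by rw [← hp2, ← h]; exact hsT'.2)
  refine ⟨p '' Icc s s', hpΓ ▸ image_subset_range _ _, (isCompact_Icc.image hp.1).isClosed,
    isPreconnected_Icc.image p hp.1.continuousOn, Set.disjoint_left.2 ?_, ?_⟩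
  · rintro _ hxS ⟨u, hu, rfl⟩
    have hpuΓ : p u ∈ Γ := hpΓ ▸ mem_range_self u
    obtain ⟨A, hA, hAd⟩ := hq x₀ hx₀Γ (p u) hpuΓ
    have hd' : C * dist x₀ (p u) ^ t ≤ C * d ^ t :=
      mul_le_mul_of_nonneg_left (Real.rpow_le_rpow dist_nonneg (hS _ hx₀S _ hxS) ht) hC
    have hfar : ∀ z ∈ A, z ∉ sphere w R := by
      intro z hz hzR
      have h1 := dist_le_diam_of_mem hA.isBounded hz hA.left_mem
      have h2 := dist_triangle z x₀ w
      have h3 := hSw x₀ hx₀S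
      rw [mem_sphere.1 hzR] at h2
      linarith
    rcases hp.mem_or_mem_of_isPreconnected hA.isPreconnected (hpΓ ▸ hA.subset) hs0 hs2 hu
      (hp0 ▸ hA.left_mem) hA.right_mem with h | h
    · exact hfar _ h hsT.2
    · exact hfar _ h hsT'.2
  · rintro z ⟨hzΓ, hzR⟩
    rw [← hpΓ, ← hp.image_Icc] at hzΓ
    obtain ⟨v, hv, rfl⟩ := hzΓ
    exact ⟨v, ⟨hs ⟨hv, hzR⟩, hs' ⟨hv, hzR⟩⟩, rfl⟩

theorem connectedComponentIn_subset_ball {F : Set ℂ} {w : ℂ} {R : ℝ} (hR : 0 < R)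
    (hF : Disjoint F (sphere w R)) (hw : w ∈ F) : connectedComponentIn F w ⊆ ball w R := by
  refine isPreconnected_connectedComponentIn.subset_left_of_subset_union isOpen_ball
    isClosed_closedBall.isOpen_compl
    (disjoint_compl_right.mono_left ball_subset_closedBall) ?_
    ⟨w, mem_connectedComponentIn hw, mem_ball_self hR⟩
  intro z hz
  have hz' : z ∉ sphere w R := Set.disjoint_left.1 hF (connectedComponentIn_subset _ _ hz)
  by_cases h : z ∈ closedBall w R
  · exact Or.inl (lt_of_le_of_ne h hz')
  · exact Or.inr h

/-- Points `w₁`, `w₂` in the same complementary component of a `t`-quasicircle can be joined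
in the complement within a ball of radius comparable to `dist w₁ w₂ ^ t`. -/
theorem TQuasicircleCond.mem_connectedComponentIn_of_lt {t C R : ℝ} {Γ : Set ℂ} {w₁ w₂ : ℂ}
    (ht : 0 ≤ t) (hC : 0 ≤ C) (hΓ : IsJordanCurve Γ) (hq : TQuasicircleCond t C Γ)
    (hw : w₂ ∈ connectedComponentIn Γᶜ w₁) (hR : dist w₁ w₂ + C * dist w₁ w₂ ^ t < R) :
    w₂ ∈ connectedComponentIn (Γ ∪ sphere w₁ R)ᶜ w₁ := by
  have hdR : dist w₁ w₂ < R := by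
    have := mul_nonneg hC (Real.rpow_nonneg (dist_nonneg (x := w₁) (y := w₂)) t)
    linarith
  have hR0 : 0 < R := dist_nonneg.trans_lt hdR
  have hw₁Γ : w₁ ∈ Γᶜ := connectedComponentIn_nonempty_iff.1 ⟨w₂, hw⟩
  have hw₁S : w₁ ∉ sphere w₁ R := by simp [hR0.ne]
  have hSw : ∀ x ∈ segment ℝ w₁ w₂, dist x w₁ ≤ dist w₁ w₂ := fun x hx => by
    have := (convex_closedBall w₁ (dist w₁ w₂)).segment_subset (mem_closedBall_self dist_nonneg)
      (mem_closedBall.2 (dist_comm w₂ w₁).le) hx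
    exact this
  have hSR : Disjoint (segment ℝ w₁ w₂) (sphere w₁ R) := Set.disjoint_left.2 fun x hx hxR => by
    have := hSw x hx
    rw [mem_sphere.1 hxR] at this
    linarith
  have hSpre : IsPreconnected (segment ℝ w₁ w₂) := (convex_segment w₁ w₂).isPreconnected
  rcases (segment ℝ w₁ w₂ ∩ Γ).eq_empty_or_nonempty with he | hne
  · refine hSpre.subset_connectedComponentIn (left_mem_segment ℝ _ _) ?_ (right_mem_segment ℝ _ _)
    exact disjoint_left.1 ((disjoint_iff_inter_eq_empty.2 he).union_right hSR)
  · have hS : ∀ x ∈ segment ℝ w₁ w₂, ∀ y ∈ segment ℝ w₁ w₂, dist x y ≤ dist w₁ w₂ := by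
      intro x hx y hy
      have h1 : diam (segment ℝ w₁ w₂) = dist w₁ w₂ := by
        rw [← convexHull_pair, convexHull_diam, diam_pair]
      rw [← h1]
      refine dist_le_diam_of_mem ?_ hx hy
      rw [← convexHull_pair, isBounded_convexHull]
      exact (Set.toFinite _).isBounded
    obtain ⟨Γ₁, hΓ₁, hcl, hpre, hdis, hsph⟩ :=
      hq.exists_isPreconnected_disjoint ht hC hΓ hS hSw hne hR
    have hunion : Γ ∪ (Γ₁ ∪ sphere w₁ R) = Γ ∪ sphere w₁ R := by
      rw [← union_assoc, union_eq_self_of_subset_right hΓ₁]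
    have hinter : Γ ∩ (Γ₁ ∪ sphere w₁ R) = Γ₁ := by
      rw [inter_union_distrib_left, inter_eq_self_of_subset_right hΓ₁,
        union_eq_self_of_subset_right hsph]
    rw [← hunion]
    refine mem_connectedComponentIn_compl_union hΓ.isCompact.isClosed (hcl.union isClosed_sphere)
      (hinter.symm ▸ hpre) ?_ hw ?_
    · rw [hunion]
      exact isBounded_ball.subset (connectedComponentIn_subset_ball hR0
        (disjoint_compl_left.mono_right subset_union_right) fun h => h.elim hw₁Γ hw₁S)
    · refine hSpre.subset_connectedComponentIn (left_mem_segment ℝ _ _) ?_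
        (right_mem_segment ℝ _ _)
      exact disjoint_left.1 (hdis.union_right hSR)

/-- If `Ω` is a `t`-quasidisk, then there is `N ≥ 1` (depending only on `t`, the
`t`-quasicircle constant `C` of `∂Ω` and `diam Ω`) such that any two points
`w₁, w₂ ∈ Ω` can be joined by a curve `γ ⊆ Ω` with `diam γ ≤ N·|w₁−w₂|^t`. -/
theorem stmt10 (t C D : ℝ) (ht : 0 < t) (ht1 : t ≤ 1) :
    ∃ N : ℝ, 1 ≤ N ∧
      ∀ (Γ Ω : Set ℂ), IsTQuasidiskWith t C Γ Ω → Metric.diam Ω = D →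
        ∀ w₁ ∈ Ω, ∀ w₂ ∈ Ω, ∃ γ : Path w₁ w₂,
          Set.range γ ⊆ Ω ∧ Metric.diam (Set.range γ) ≤ N * dist w₁ w₂ ^ t := by
  refine ⟨max 1 (4 * (D ^ (1 - t) + C)), le_max_left _ _, ?_⟩
  rintro Γ Ω ⟨hΓ, hC, hq, hbd, x, -, rfl⟩ hD w₁ hw₁ w₂ hw₂
  rcases eq_or_ne w₁ w₂ with rfl | hne
  · refine ⟨Path.refl w₁, by simpa using hw₁, ?_⟩
    simp only [Path.refl_range, diam_singleton]
    positivity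
  have hd : 0 < dist w₁ w₂ := dist_pos.2 hne
  have hdt : 0 < dist w₁ w₂ ^ t := Real.rpow_pos_of_pos hd t
  have hdD : dist w₁ w₂ ≤ D ^ (1 - t) * dist w₁ w₂ ^ t := by
    calc dist w₁ w₂ = dist w₁ w₂ ^ (1 - t) * dist w₁ w₂ ^ t := by
          rw [← Real.rpow_add hd, sub_add_cancel, Real.rpow_one]
      _ ≤ D ^ (1 - t) * dist w₁ w₂ ^ t := by
          gcongr
          exact hD ▸ dist_le_diam_of_mem hbd hw₁ hw₂
  set R := 2 * ((D ^ (1 - t) + C) * dist w₁ w₂ ^ t) with hRdef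
  have hCd : 0 < C * dist w₁ w₂ ^ t := by positivity
  have hRlt : dist w₁ w₂ + C * dist w₁ w₂ ^ t < R := by
    rw [hRdef, add_mul]
    linarith
  have hR0 : 0 < R := by linarith
  have hΩ : connectedComponentIn Γᶜ x = connectedComponentIn Γᶜ w₁ := connectedComponentIn_eq hw₁
  have hw₁Γ : w₁ ∉ Γ := connectedComponentIn_subset _ _ hw₁
  have hmem := hq.mem_connectedComponentIn_of_lt ht.le (by linarith) hΓ (hΩ ▸ hw₂) hRlt
  have hw₁' : w₁ ∈ (Γ ∪ sphere w₁ R)ᶜ := connectedComponentIn_nonempty_iff.1 ⟨_, hmem⟩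
  have hball := connectedComponentIn_subset_ball hR0
    (disjoint_compl_left.mono_right (subset_union_right (s := Γ))) hw₁'
  have hopen : IsOpen (connectedComponentIn (Γ ∪ sphere w₁ R)ᶜ w₁) :=
    (hΓ.isCompact.isClosed.union isClosed_sphere).isOpen_compl.connectedComponentIn
  have hpc := hopen.isConnected_iff_isPathConnected.1 (isConnected_connectedComponentIn_iff.2 hw₁')
  obtain ⟨γ, hγ⟩ := hpc.joinedIn w₁ (mem_connectedComponentIn hw₁') w₂ hmem
  have hγ' : range γ ⊆ connectedComponentIn (Γ ∪ sphere w₁ R)ᶜ w₁ := range_subset_iff.2 hγ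
  refine ⟨γ, ?_, ?_⟩
  · rw [hΩ]
    exact hγ'.trans (connectedComponentIn_mono _ (compl_subset_compl.2 subset_union_left))
  · calc diam (range γ) ≤ diam (ball w₁ R) := diam_mono (hγ'.trans hball) isBounded_ball
      _ ≤ 2 * R := diam_ball hR0.le
      _ = 4 * (D ^ (1 - t) + C) * dist w₁ w₂ ^ t := by rw [hRdef]; ring
      _ ≤ _ := by
          gcongr
          exact le_max_right _ _
end

section
/- Let 0 < t ≤ 1, let Ω be a t-quasidisk, and let f be a conformal map of 𝔻 onto Ω with induced boundary values f : 𝕋 → ∂Ω. Then there exists a strictly increasing function η : [0,∞) → [0,∞) (an increasing injection, depending on f) such that for all a, b, x ∈ 𝕋 and all k ≥ 1: if |a−x| = k·|x−b| then |f(a) − f(x)| ≤ η(k)·|f(b) − f(x)|^(t²). -/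
open Metric Set Real

/-- `Ω` is a `t`-quasidisk with boundary `Γ`: the bounded connected component of the
complement of a `t`-quasicircle `Γ`. -/
def IsTQuasidisk (t : ℝ) (Γ Ω : Set ℂ) : Prop :=
  IsJordanCurve Γ ∧ (∃ C : ℝ, 1 ≤ C ∧ TQuasicircleCond t C Γ) ∧ Bornology.IsBounded Ω ∧
    ∃ x ∈ Γᶜ, Ω = connectedComponentIn Γᶜ x

open MeasureTheory in
theorem lintegral_annulus_le {r R : ℝ} (hr : 0 < r) (hrR : r < R) :
    ∫⁻ w in {w : ℂ | r < ‖w‖ ∧ ‖w‖ < R}, ENNReal.ofReal ((‖w‖ ^ 2)⁻¹) ≤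
      ENNReal.ofReal (2 * π * Real.log (R / r)) := by
  have hm : MeasurableSet {w : ℂ | r < ‖w‖ ∧ ‖w‖ < R} :=
    ((isOpen_lt continuous_const continuous_norm).inter
      (isOpen_lt continuous_norm continuous_const)).measurableSet
  rw [← lintegral_indicator hm, ← Complex.lintegral_comp_polarCoord_symm]
  have hi : ∫⁻ u in Ioo r R, ENNReal.ofReal (u⁻¹) = ENNReal.ofReal (Real.log (R / r)) := by
    have h0 : (0 : ℝ) ∉ uIcc r R := by
      rw [uIcc_of_le hrR.le]; exact fun h => absurd h.1 (not_le.2 hr)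
    rw [← integral_inv h0, intervalIntegral.integral_of_le hrR.le, ← integral_Ioc_eq_integral_Ioo.symm,
      ofReal_integral_eq_lintegral_ofReal]
    · have : IntervalIntegrable (fun x : ℝ => x⁻¹) volume r R :=
        intervalIntegral.intervalIntegrable_inv (fun x hx h => h0 (h ▸ hx)) continuousOn_id
      exact this.1.mono_set Ioo_subset_Ioc_self
    · refine (ae_restrict_mem measurableSet_Ioo).mono fun x hx => ?_
      exact inv_nonneg.2 (hr.le.trans hx.1.le)
  calc _ ≤ ∫⁻ p : ℝ × ℝ in Ioi (0 : ℝ) ×ˢ Ioo (-π) π,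
        (Ioo r R).indicator (fun u => ENNReal.ofReal (u⁻¹)) p.1 := by
        rw [show polarCoord.target = Ioi (0 : ℝ) ×ˢ Ioo (-π) π from rfl]
        refine setLIntegral_mono' (measurableSet_Ioi.prod measurableSet_Ioo) fun p hp => ?_
        have hp1 : 0 < p.1 := hp.1
        by_cases h : p.1 ∈ Ioo r R
        · rw [indicator_of_mem h, indicator_of_mem, smul_eq_mul, ← ENNReal.ofReal_mul hp1.le,
            Complex.norm_polarCoord_symm, abs_of_pos hp1]
          · apply le_of_eq; congr 1; field_simp
          · simp only [mem_ofPred_eq, Complex.norm_polarCoord_symm, abs_of_pos hp1]; exact h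
        · rw [indicator_of_notMem h, indicator_of_notMem]
          · simp
          · simp only [mem_ofPred_eq, Complex.norm_polarCoord_symm, abs_of_pos hp1]; exact h
    _ ≤ ∫⁻ u : ℝ, ∫⁻ _v : ℝ in Ioo (-π) π,
          (Ioo r R).indicator (fun u => ENNReal.ofReal (u⁻¹)) u := by
        rw [Measure.volume_eq_prod, ← Measure.prod_restrict, lintegral_prod]
        · exact lintegral_mono' Measure.restrict_le_self le_rfl
        · refine Measurable.aemeasurable ?_
          exact ((by fun_prop : Measurable fun u : ℝ => ENNReal.ofReal (u⁻¹)).indicator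
            measurableSet_Ioo).comp measurable_fst
    _ = _ := by
        simp only [setLIntegral_const, Real.volume_Ioo]
        rw [lintegral_mul_const' _ _ ENNReal.ofReal_ne_top, lintegral_indicator measurableSet_Ioo,
          hi, ← ENNReal.ofReal_mul (Real.log_nonneg ((one_le_div hr).2 hrR.le))]
        congr 1; ring

theorem Complex.abs_det_restrictScalars_toSpanSingleton (c : ℂ) :
    |((ContinuousLinearMap.toSpanSingleton ℂ c).restrictScalars ℝ).det| = ‖c‖ ^ 2 := by
  have h : ((ContinuousLinearMap.toSpanSingleton ℂ c).restrictScalars ℝ).det = Complex.normSq c := by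
    simp [ContinuousLinearMap.det, LinearMap.det_restrictScalars, Algebra.norm_complex_apply]
  rw [h, abs_of_nonneg (Complex.normSq_nonneg c), Complex.normSq_eq_norm_sq]

open MeasureTheory in
theorem lintegral_norm_deriv_div_norm_sq_le {F : ℂ → ℂ} {S : Set ℂ} (hS : MeasurableSet S)
    (hF : ∀ z ∈ S, DifferentiableAt ℂ F z) (hinj : InjOn F S) {r R : ℝ} (hr : 0 < r) (hrR : r < R)
    (hSF : ∀ z ∈ S, r < ‖F z‖ ∧ ‖F z‖ < R) :
    ∫⁻ z in S, ENNReal.ofReal ((‖deriv F z‖ / ‖F z‖) ^ 2) ≤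
      ENNReal.ofReal (2 * π * Real.log (R / r)) := by
  refine le_trans ?_ (lintegral_annulus_le hr hrR)
  have h := lintegral_image_eq_lintegral_abs_det_fderiv_mul volume hS
    (fun z hz => ((hF z hz).hasDerivAt.hasFDerivAt.restrictScalars ℝ).hasFDerivWithinAt) hinj
    (fun w : ℂ => ENNReal.ofReal ((‖w‖ ^ 2)⁻¹))
  calc _ = ∫⁻ w in F '' S, ENNReal.ofReal ((‖w‖ ^ 2)⁻¹) := by
        rw [h]
        refine setLIntegral_congr_fun hS fun z _ => ?_
        rw [Complex.abs_det_restrictScalars_toSpanSingleton, ← ENNReal.ofReal_mul (by positivity)]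
        congr 1; rw [div_pow, div_eq_mul_inv]
    _ ≤ _ := lintegral_mono_set (by rintro _ ⟨z, hz, rfl⟩; exact hSF z hz)

open MeasureTheory in
theorem ofReal_log_sq_div_pi_le_lintegral {γ γ' : ℝ → ℂ} {a b r R : ℝ} (hab : a ≤ b)
    (hba : b - a ≤ π) (hr : 0 < r) (hrR : r < R) (hc : ContinuousOn γ (Icc a b))
    (hd : ∀ θ ∈ Ioo a b, HasDerivAt γ (γ' θ) θ) (hc' : ContinuousOn γ' (Ioo a b))
    (hra : ‖γ a‖ ≤ r) (hRb : R ≤ ‖γ b‖) {K : ℝ → ENNReal}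
    (hK : ∀ θ ∈ Ioo a b, r < ‖γ θ‖ → ‖γ θ‖ < R →
      ENNReal.ofReal ((‖γ' θ‖ / ‖γ θ‖) ^ 2) ≤ K θ) :
    ENNReal.ofReal (Real.log (R / r) ^ 2 / π) ≤
      ∫⁻ θ, K θ := by
  have hn : ContinuousOn (fun θ => ‖γ θ‖) (Icc a b) := hc.norm
  obtain ⟨v, hv⟩ : ∃ v, IsLeast {θ | θ ∈ Icc a b ∧ R ≤ ‖γ θ‖} v := by
    refine IsCompact.exists_isLeast ?_ ⟨b, right_mem_Icc.2 hab, hRb⟩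
    exact isCompact_Icc.of_isClosed_subset
      (hn.preimage_isClosed_of_isClosed isClosed_Icc isClosed_Ici) fun θ h => h.1
  have hvb : Icc a v ⊆ Icc a b := Icc_subset_Icc_right hv.1.1.2
  obtain ⟨u, hu⟩ : ∃ u, IsGreatest {θ | θ ∈ Icc a v ∧ ‖γ θ‖ ≤ r} u := by
    refine IsCompact.exists_isGreatest ?_ ⟨a, left_mem_Icc.2 hv.1.1.1, hra⟩
    exact isCompact_Icc.of_isClosed_subset
      ((hn.mono hvb).preimage_isClosed_of_isClosed isClosed_Icc isClosed_Iic) fun θ h => h.1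
  have huv : u ≤ v := hu.1.1.2
  have hsub : Icc u v ⊆ Icc a b := Icc_subset_Icc hu.1.1.1 hv.1.1.2
  have hsubo : Ioo u v ⊆ Ioo a b := Ioo_subset_Ioo hu.1.1.1 hv.1.1.2
  have hγu : ‖γ u‖ = r := by
    obtain ⟨θ, hθ, hθr⟩ := intermediate_value_Icc huv (hn.mono hsub)
      ⟨hu.1.2, hrR.le.trans hv.1.2⟩
    have : θ = u := le_antisymm (hu.2 ⟨⟨hu.1.1.1.trans hθ.1, hθ.2⟩, hθr.le⟩) hθ.1
    rw [← this]; exact hθr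
  have hlt : ∀ θ ∈ Ioo u v, r < ‖γ θ‖ ∧ ‖γ θ‖ < R := fun θ hθ => by
    refine ⟨not_le.1 fun h => ?_, not_le.1 fun h => ?_⟩
    · exact absurd (hu.2 ⟨⟨hu.1.1.1.trans hθ.1.le, hθ.2.le⟩, h⟩) (not_le.2 hθ.1)
    · exact absurd (hv.2 ⟨⟨hu.1.1.1.trans hθ.1.le, hθ.2.le.trans hv.1.1.2⟩, h⟩) (not_le.2 hθ.2)
  have hge : ∀ θ ∈ Icc u v, 0 < ‖γ θ‖ := fun θ hθ => by
    rcases eq_or_lt_of_le hθ.1 with h | h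
    · rw [← h, hγu]; exact hr
    · exact hr.trans (not_le.1 fun h' => absurd (hu.2 ⟨⟨hu.1.1.1.trans hθ.1, hθ.2⟩, h'⟩)
        (not_le.2 h))
  set h : ℝ → ℝ := fun θ => (‖γ' θ‖ / ‖γ θ‖) ^ 2 with hh
  have hle : ∫⁻ θ in Ioo u v, ENNReal.ofReal (h θ) ≤ ∫⁻ θ, K θ :=
    (setLIntegral_mono' measurableSet_Ioo fun θ hθ =>
      hK θ (hsubo hθ) (hlt θ hθ).1 (hlt θ hθ).2).trans (setLIntegral_le_lintegral _ _)
  refine le_trans ?_ hle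
  rcases eq_or_ne (∫⁻ θ in Ioo u v, ENNReal.ofReal (h θ)) ⊤ with htop | htop
  · exact htop ▸ le_top
  have hh0 : ∀ θ, 0 ≤ h θ := fun θ => sq_nonneg _
  have hmeas : AEStronglyMeasurable h (volume.restrict (Ioo u v)) := by
    refine ContinuousOn.aestronglyMeasurable ?_ measurableSet_Ioo
    exact (((hc'.mono hsubo).norm).div (hn.mono (hsubo.trans Ioo_subset_Icc_self))
      fun θ hθ => (hge θ (Ioo_subset_Icc_self hθ)).ne').pow 2
  have hint : IntegrableOn h (Ioo u v) :=
    ⟨hmeas, by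
      rw [hasFiniteIntegral_iff_ofReal (Filter.Eventually.of_forall hh0)]
      exact lt_top_iff_ne_top.2 htop⟩
  set l : ℝ := Real.log (R / r) / π with hl
  have hL : 0 < Real.log (R / r) := Real.log_pos ((one_lt_div hr).2 hrR)
  have hlpos : 0 < l := div_pos hL pi_pos
  have hgc : ContinuousOn (fun θ => Real.log (‖γ θ‖ ^ 2) / 2) (Icc u v) := by
    have h2 : ContinuousOn (fun θ => ‖γ θ‖ ^ 2) (Icc u v) := (hn.mono hsub).pow 2
    have h3 : ContinuousOn (fun θ => Real.log (‖γ θ‖ ^ 2)) (Icc u v) :=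
      h2.log fun θ hθ => (pow_pos (hge θ hθ) 2).ne'
    exact h3.div_const 2
  have hφ : IntegrableOn (fun θ => (h θ / l + l) / 2) (Icc u v) := by
    rw [integrableOn_Icc_iff_integrableOn_Ioo]
    have h1 : IntegrableOn (fun θ => h θ / l + l) (Ioo u v) :=
      (hint.div_const l).add (integrableOn_const (by simp))
    exact h1.div_const 2
  have key := intervalIntegral.sub_le_integral_of_hasDeriv_right_of_le
    (g := fun θ => Real.log (‖γ θ‖ ^ 2) / 2)
    (g' := fun θ => 2 * inner ℝ (γ θ) (γ' θ) / ‖γ θ‖ ^ 2 / 2)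
    (φ := fun θ => (h θ / l + l) / 2) huv
    hgc
    (fun θ hθ => by
      refine HasDerivAt.hasDerivWithinAt (HasDerivAt.div_const (HasDerivAt.log ?_ ?_) 2)
      · exact (hd θ (hsubo hθ)).norm_sq
      · exact (pow_pos (hge θ (Ioo_subset_Icc_self hθ)) 2).ne')
    hφ
    (fun θ hθ => by
      have hp := hge θ (Ioo_subset_Icc_self hθ)
      have h1 : inner ℝ (γ θ) (γ' θ) ≤ ‖γ θ‖ * ‖γ' θ‖ := real_inner_le_norm _ _
      have h2 : 2 * inner ℝ (γ θ) (γ' θ) / ‖γ θ‖ ^ 2 / 2 ≤ ‖γ' θ‖ / ‖γ θ‖ := by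
        rw [div_div, div_le_div_iff₀ (by positivity) hp]
        nlinarith
      refine h2.trans ?_
      simp only [hh]
      set q := ‖γ' θ‖ / ‖γ θ‖
      rw [le_div_iff₀ two_pos, ← sub_nonneg]
      have : q ^ 2 / l + l - q * 2 = (q - l) ^ 2 / l := by field_simp; ring
      rw [this]; positivity)
  have hval : ∫ θ in u..v, (h θ / l + l) / 2 = ((∫ θ in Ioo u v, h θ) / l + l * (v - u)) / 2 := by
    rw [intervalIntegral.integral_of_le huv, integral_Ioc_eq_integral_Ioo, integral_div,
      integral_add (hint.div_const l) (integrableOn_const (by simp)), integral_div]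
    simp [huv, mul_comm]
  rw [hval] at key
  simp only [Real.log_pow, hγu] at key
  rw [← ofReal_integral_eq_lintegral_ofReal hint (Filter.Eventually.of_forall hh0)]
  refine ENNReal.ofReal_le_ofReal ?_
  have hlog : Real.log (R / r) = Real.log R - Real.log r :=
    Real.log_div (hr.trans hrR).ne' hr.ne'
  have hlogv : Real.log R ≤ Real.log ‖γ v‖ := Real.log_le_log (hr.trans hrR) hv.1.2
  have hvu : v - u ≤ π := by linarith [hu.1.1.1, hv.1.1.2]
  have h3 : l * (v - u) ≤ Real.log (R / r) := by
    calc l * (v - u) ≤ l * π := by gcongr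
      _ = _ := by rw [hl]; field_simp
  have h4 : Real.log (R / r) ≤ (∫ θ in Ioo u v, h θ) / l := by
    push_cast at key; linarith
  rw [le_div_iff₀ hlpos] at h4
  calc Real.log (R / r) ^ 2 / π = Real.log (R / r) * l := by rw [hl]; ring
    _ ≤ _ := h4

open MeasureTheory in
theorem log_div_mul_log_div_le {f : ℂ → ℂ} (hfc : ContinuousOn f (closedBall (0 : ℂ) 1))
    (hfd : DifferentiableOn ℂ f (ball (0 : ℂ) 1)) (hfi : InjOn f (closedBall (0 : ℂ) 1))
    {m w₀ : ℂ} (hm : ‖m‖ = 1) {r R ρ₁ ρ₂ : ℝ} (hr : 0 < r) (hrR : r < R) (hρ₁ : 0 < ρ₁)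
    (hρ : ρ₁ < ρ₂)
    (hy : ∀ ρ ∈ Ioo ρ₁ ρ₂, ∃ y : ℂ, ‖y‖ = 1 ∧ ‖y - m‖ = ρ ∧ ‖f y - w₀‖ ≤ r ∧
      R ≤ ‖f (m ^ 2 * starRingEnd ℂ y) - w₀‖) :
    Real.log (R / r) * Real.log (ρ₂ / ρ₁) ≤ 2 * π ^ 2 := by
  set e : ℂ → ℂ := fun z => m * (1 - Complex.exp z) with he
  set F : ℂ → ℂ := fun z => f (e z) - w₀ with hF
  have hed : Differentiable ℂ e := by fun_prop
  set V : Set ℂ := {z | (z.re ∈ Ioo (Real.log ρ₁) (Real.log ρ₂) ∧ z.im ∈ Ioo (-(π / 2)) (π / 2)) ∧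
    e z ∈ ball (0 : ℂ) 1} with hV
  have hVo : IsOpen V :=
    ((isOpen_Ioo.preimage Complex.continuous_re).inter
      (isOpen_Ioo.preimage Complex.continuous_im)).inter (isOpen_ball.preimage hed.continuous)
  have hFd : DifferentiableOn ℂ F V := fun z hz =>
    ((((hfd.differentiableAt (isOpen_ball.mem_nhds hz.2)).comp z (hed z)).sub_const w₀)
      ).differentiableWithinAt
  have hFat : ∀ z ∈ V, DifferentiableAt ℂ F z := fun z hz =>
    hFd.differentiableAt (hVo.mem_nhds hz)
  have hF'c : ContinuousOn (deriv F) V := (hFd.deriv hVo).continuousOn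
  set S : Set ℂ := V ∩ F ⁻¹' {w | r < ‖w‖ ∧ ‖w‖ < R} with hS
  have hSo : IsOpen S := hFd.continuousOn.isOpen_inter_preimage hVo
    ((isOpen_lt continuous_const continuous_norm).inter
      (isOpen_lt continuous_norm continuous_const))
  have hm0 : m ≠ 0 := norm_ne_zero_iff.1 (by rw [hm]; exact one_ne_zero)
  have hinj : InjOn F S := fun z hz w hw h => by
    have h1 : e z = e w := hfi (ball_subset_closedBall hz.1.2) (ball_subset_closedBall hw.1.2)
      (sub_left_injective h)
    have h2 : Complex.exp z = Complex.exp w := sub_right_injective (mul_left_cancel₀ hm0 h1)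
    have hz' := hz.1.1.2
    have hw' := hw.1.1.2
    have := pi_pos
    rw [← Complex.log_exp (x := z), h2, Complex.log_exp] <;>
      first | linarith [hz'.1] | linarith [hz'.2] | linarith [hw'.1] | linarith [hw'.2]
  set H : ℂ → ENNReal := fun z => ENNReal.ofReal ((‖deriv F z‖ / ‖F z‖) ^ 2) with hH
  have harea : ∫⁻ z in S, H z ≤ ENNReal.ofReal (2 * π * Real.log (R / r)) :=
    lintegral_norm_deriv_div_norm_sq_le hSo.measurableSet (fun z hz => hFat z hz.1) hinj hr hrR
      fun z hz => hz.2
  have hHm : AEMeasurable (S.indicator H) volume := by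
    rw [aemeasurable_indicator_iff hSo.measurableSet]
    refine AEMeasurable.ennreal_ofReal (ContinuousOn.aemeasurable ?_ hSo.measurableSet)
    exact (((hF'c.mono inter_subset_left).norm).div (hFd.continuousOn.mono inter_subset_left).norm
      fun z hz => (hr.trans hz.2.1).ne').pow 2
  have hslice : ∀ s ∈ Ioo (Real.log ρ₁) (Real.log ρ₂),
      ENNReal.ofReal (Real.log (R / r) ^ 2 / π) ≤
        ∫⁻ θ : ℝ, S.indicator H (Complex.measurableEquivRealProd.symm (s, θ)) := by
    intro s hs
    obtain ⟨y, hy1, hym, hyr, hyR⟩ := hy (Real.exp s)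
      ⟨(Real.log_lt_iff_lt_exp hρ₁).1 hs.1, (Real.lt_log_iff_exp_lt (hρ₁.trans hρ)).1 hs.2⟩
    have hmm : m * starRingEnd ℂ m = 1 := by
      rw [Complex.mul_conj, Complex.normSq_eq_norm_sq, hm]; norm_num
    set ζ : ℂ := 1 - y * starRingEnd ℂ m with hζ
    have hζn : ‖ζ‖ = Real.exp s := by
      rw [← hym, ← norm_neg (y - m), ← mul_one ‖-(y - m)‖, ← hm, ← RCLike.norm_conj m, ← norm_mul]
      congr 1
      linear_combination -hmm
    have hnorm : ∀ θ : ℝ, ‖e (s + θ * Complex.I)‖ ^ 2 =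
        1 - 2 * Real.exp s * Real.cos θ + Real.exp s ^ 2 := by
      intro θ
      have h2 := Real.sin_sq_add_cos_sq θ
      simp only [he]
      rw [norm_mul, hm, one_mul, Complex.exp_add, ← Complex.ofReal_exp, Complex.exp_mul_I,
        ← Complex.ofReal_cos, ← Complex.ofReal_sin, ← Complex.normSq_eq_norm_sq,
        Complex.normSq_apply]
      simp [-Complex.ofReal_exp, -Complex.ofReal_cos, -Complex.ofReal_sin]
      linear_combination (Real.exp s) ^ 2 * h2
    set α : ℝ := Complex.arg ζ with hα
    have hζe : Complex.exp (s + α * Complex.I) = ζ := by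
      rw [Complex.exp_add, ← Complex.ofReal_exp, ← hζn, hα, Complex.norm_mul_exp_arg_mul_I]
    have heα : e (s + α * Complex.I) = y := by
      simp only [he]; rw [hζe, hζ]; linear_combination y * hmm
    have heα' : e (s + (-α : ℝ) * Complex.I) = m ^ 2 * starRingEnd ℂ y := by
      have : Complex.exp (s + (-α : ℝ) * Complex.I) = starRingEnd ℂ ζ := by
        rw [← hζe, ← Complex.exp_conj]; simp
      simp only [he]; rw [this, hζ]; simp; ring
    have hcosα : 2 * Real.cos α = Real.exp s := by
      have h1 := hnorm α
      rw [heα, hy1] at h1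
      have h3 : Real.exp s * (2 * Real.cos α) = Real.exp s * Real.exp s := by linarith
      exact mul_left_cancel₀ (Real.exp_pos s).ne' h3
    have hαlt : |α| < π / 2 := by
      by_contra h
      have := Real.cos_nonpos_of_pi_div_two_le_of_le (not_lt.1 h)
        ((Complex.abs_arg_le_pi ζ).trans (by linarith [pi_pos]))
      rw [Real.cos_abs] at this
      linarith [Real.exp_pos s]
    have hle : ∀ θ : ℝ, |θ| ≤ |α| → ‖e (s + θ * Complex.I)‖ ≤ 1 := by
      intro θ hθ
      have h1 : Real.cos |α| ≤ Real.cos |θ| :=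
        Real.cos_le_cos_of_nonneg_of_le_pi (abs_nonneg _) (by linarith [pi_pos]) hθ
      rw [Real.cos_abs, Real.cos_abs] at h1
      have h2 := hnorm θ
      rw [← sq_le_one_iff₀ (norm_nonneg _)]
      nlinarith [Real.exp_pos s]
    have hlt : ∀ θ : ℝ, |θ| < |α| → (s + θ * Complex.I : ℂ) ∈ V := by
      intro θ hθ
      have h1 : Real.cos |α| < Real.cos |θ| :=
        Real.cos_lt_cos_of_nonneg_of_le_pi (abs_nonneg _) (by linarith [pi_pos]) hθ
      rw [Real.cos_abs, Real.cos_abs] at h1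
      have h2 := hnorm θ
      have h3 := abs_lt.1 (hθ.trans hαlt)
      refine ⟨⟨by simpa using hs, by simpa using h3⟩, ?_⟩
      rw [mem_ball_zero_iff, ← sq_lt_one_iff₀ (norm_nonneg _)]
      nlinarith [Real.exp_pos s]
    obtain ⟨c, hc, hcα⟩ : ∃ c : ℝ, (c = 1 ∨ c = -1) ∧ α = c * -|α| := by
      rcases le_total α 0 with h | h
      · exact ⟨1, Or.inl rfl, by rw [abs_of_nonpos h]; ring⟩
      · exact ⟨-1, Or.inr rfl, by rw [abs_of_nonneg h]; ring⟩
    have hcabs : ∀ θ : ℝ, |c * θ| = |θ| := fun θ => by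
      rcases hc with rfl | rfl <;> simp
    set l : ℝ → ℂ := fun θ => s + (c * θ : ℝ) * Complex.I with hl
    have hld : ∀ θ, HasDerivAt l (c * Complex.I) θ := fun θ => by
      have h1 : HasDerivAt (fun θ : ℝ => c * θ) c θ := by
        simpa using (hasDerivAt_id θ).const_mul c
      exact (h1.ofReal_comp.mul_const Complex.I).const_add (s : ℂ)
    have hlc : Continuous l := continuous_iff_continuousAt.2 fun θ => (hld θ).continuousAt
    have hlV : ∀ θ ∈ Ioo (-|α|) |α|, l θ ∈ V := fun θ hθ =>
      hlt _ (by rw [hcabs]; exact abs_lt.2 hθ)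
    have hpath := ofReal_log_sq_div_pi_le_lintegral (γ := fun θ => F (l θ))
      (γ' := fun θ => deriv F (l θ) * (c * Complex.I)) (a := -|α|) (b := |α|)
      (by linarith [abs_nonneg α]) (by linarith) hr hrR
      (by
        refine ContinuousOn.sub ?_ continuousOn_const
        refine hfc.comp (hed.continuous.comp hlc).continuousOn fun θ hθ => ?_
        rw [mem_closedBall_zero_iff]
        exact hle _ (by rw [hcabs]; exact abs_le.2 hθ))
      (fun θ hθ => by
        have := (hFat _ (hlV θ hθ)).hasDerivAt.scomp θ (hld θ)
        simpa [mul_comm, Function.comp_def] using this)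
      ((hF'c.comp hlc.continuousOn hlV).mul continuousOn_const)
      (by
        have : l (-|α|) = s + α * Complex.I := by simp only [hl]; rw [← hcα]
        simp only [this, hF, heα]; exact hyr)
      (by
        have : l |α| = s + (-α : ℝ) * Complex.I := by
          simp only [hl]; rw [show c * |α| = -α by linarith]
        simp only [this, hF, heα']; exact hyR)
      (K := fun θ => S.indicator H (l θ))
      (fun θ hθ h1 h2 => by
        rw [indicator_of_mem (show l θ ∈ S from ⟨hlV θ hθ, h1, h2⟩)]
        have : ‖(c : ℂ) * Complex.I‖ = 1 := by
          rcases hc with rfl | rfl <;> simp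
        rw [norm_mul, this, mul_one])
    refine hpath.trans (le_of_eq ?_)
    have hs' : ∀ θ : ℝ, Complex.measurableEquivRealProd.symm (s, θ) = s + θ * Complex.I := fun θ => by
      apply Complex.ext <;> simp [Complex.measurableEquivRealProd]
    simp only [hs', hl]
    rcases hc with rfl | rfl
    · simp only [one_mul]
    · simp only [neg_one_mul]
      exact lintegral_neg_eq_self (μ := volume)
        (fun θ : ℝ => S.indicator H ((s : ℂ) + (θ : ℂ) * Complex.I))
  have hfub : ∫⁻ z in S, H z =
      ∫⁻ s : ℝ, ∫⁻ θ : ℝ, S.indicator H (Complex.measurableEquivRealProd.symm (s, θ)) := by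
    rw [← lintegral_indicator hSo.measurableSet,
      ← (Complex.volume_preserving_equiv_real_prod.symm).lintegral_comp_emb
        Complex.measurableEquivRealProd.symm.measurableEmbedding, Measure.volume_eq_prod,
      lintegral_prod]
    exact hHm.comp_quasiMeasurePreserving
      Complex.volume_preserving_equiv_real_prod.symm.quasiMeasurePreserving
  have hL : 0 < Real.log (R / r) := Real.log_pos ((one_lt_div hr).2 hrR)
  have hρ₂ := hρ₁.trans hρ
  have hlog : Real.log (ρ₂ / ρ₁) = Real.log ρ₂ - Real.log ρ₁ := Real.log_div hρ₂.ne' hρ₁.ne'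
  have hlog0 : 0 < Real.log (ρ₂ / ρ₁) := Real.log_pos ((one_lt_div hρ₁).2 hρ)
  have hfin : ENNReal.ofReal (Real.log (R / r) ^ 2 / π * Real.log (ρ₂ / ρ₁)) ≤
      ENNReal.ofReal (2 * π * Real.log (R / r)) := by
    calc _ = ∫⁻ s in Ioo (Real.log ρ₁) (Real.log ρ₂),
          ENNReal.ofReal (Real.log (R / r) ^ 2 / π) := by
          rw [setLIntegral_const, Real.volume_Ioo, ← hlog, ENNReal.ofReal_mul (by positivity)]
      _ ≤ _ := setLIntegral_mono' measurableSet_Ioo hslice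
      _ ≤ _ := setLIntegral_le_lintegral _ _
      _ ≤ _ := hfub ▸ harea
  rw [ENNReal.ofReal_le_ofReal_iff (by positivity)] at hfin
  have h1 : Real.log (R / r) * (Real.log (R / r) * Real.log (ρ₂ / ρ₁)) ≤
      Real.log (R / r) * (2 * π ^ 2) := by
    calc _ = Real.log (R / r) ^ 2 / π * Real.log (ρ₂ / ρ₁) * π := by field_simp
      _ ≤ 2 * π * Real.log (R / r) * π := by gcongr
      _ = _ := by ring
  exact le_of_mul_le_mul_left h1 hL
theorem IsCompact.continuousOn_invFunOn_image {X Y : Type*} [TopologicalSpace X] [TopologicalSpace Y]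
    [T2Space Y] [Nonempty X] {g : X → Y} {K : Set X} (hK : IsCompact K) (hg : ContinuousOn g K)
    (hi : InjOn g K) : ContinuousOn (Function.invFunOn g K) (g '' K) := by
  rw [continuousOn_iff_isClosed]
  intro C hC
  refine ⟨g '' (K ∩ C), ((hK.inter_right hC).image_of_continuousOn
    (hg.mono inter_subset_left)).isClosed, ?_⟩
  ext w
  constructor
  · rintro ⟨hw, z, hz, rfl⟩
    rw [mem_preimage, hi.leftInvOn_invFunOn hz] at hw
    exact ⟨⟨z, ⟨hz, hw⟩, rfl⟩, z, hz, rfl⟩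
  · rintro ⟨⟨z, ⟨hz, hzC⟩, rfl⟩, h⟩
    refine ⟨?_, h⟩
    rwa [mem_preimage, hi.leftInvOn_invFunOn hz]

theorem not_injOn_sphere_of_continuousOn {ψ : ℂ → ℝ} (hc : ContinuousOn ψ (sphere (0 : ℂ) 1)) :
    ¬ InjOn ψ (sphere (0 : ℂ) 1) := by
  intro hi
  have hmem : ∀ θ : ℝ, Complex.exp (θ * Complex.I) ∈ sphere (0 : ℂ) 1 := fun θ => by
    rw [mem_sphere_zero_iff_norm, Complex.norm_exp_ofReal_mul_I]
  have hmem' : ∀ θ : ℝ, -Complex.exp (θ * Complex.I) ∈ sphere (0 : ℂ) 1 := fun θ => by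
    rw [mem_sphere_zero_iff_norm, norm_neg, Complex.norm_exp_ofReal_mul_I]
  set g : ℝ → ℝ := fun θ => ψ (Complex.exp (θ * Complex.I)) - ψ (-Complex.exp (θ * Complex.I))
  have hg : Continuous g :=
    (hc.comp_continuous (by fun_prop) hmem).sub (hc.comp_continuous (by fun_prop) hmem')
  have hπ : g π = -g 0 := by simp [g]
  obtain ⟨θ, -, hθ⟩ : (0 : ℝ) ∈ g '' uIcc 0 π := by
    refine intermediate_value_uIcc hg.continuousOn ?_
    rw [hπ, mem_uIcc]
    rcases le_total (g 0) 0 with h | h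
    · exact Or.inl ⟨h, by linarith⟩
    · exact Or.inr ⟨by linarith, h⟩
  have h := hi (hmem θ) (hmem' θ) (sub_eq_zero.1 hθ)
  exact Complex.exp_ne_zero (θ * Complex.I) (self_eq_neg.1 h)

theorem IsJordanParam.injOn_Ico {p : ℝ → ℂ} (hp : IsJordanParam p) (s : ℝ) :
    InjOn p (Ico s (s + 2 * π)) := by
  intro u hu v hv huv
  have h2 : (0 : ℝ) < 2 * π := by positivity
  have h0 : ∀ w, p (toIcoMod h2 0 w) = p w := fun w => by
    rw [toIcoMod]; exact hp.2.1.sub_zsmul_eq _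
  have hm : ∀ w, toIcoMod h2 0 w ∈ Ico 0 (2 * π) := fun w => by
    simpa using toIcoMod_mem_Ico h2 0 w
  have h := hp.2.2 (hm u) (hm v) (by rw [h0, h0, huv])
  rw [toIcoMod_inj] at h
  have hu' := (toIcoMod_eq_self h2).2 hu
  have hv' := (toIcoMod_eq_self h2).2 hv
  rw [← hu', ← hv', toIcoMod_inj]
  exact h

theorem image_sphere_eq_of_isJordanCurve {f : ℂ → ℂ} {Γ : Set ℂ} (hΓ : IsJordanCurve Γ)
    (hc : ContinuousOn f (sphere (0 : ℂ) 1)) (hi : InjOn f (sphere (0 : ℂ) 1))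
    (hsub : f '' sphere (0 : ℂ) 1 ⊆ Γ) : f '' sphere (0 : ℂ) 1 = Γ := by
  refine hsub.antisymm fun z hz => ?_
  by_contra hzf
  obtain ⟨p, hp, rfl⟩ := hΓ
  obtain ⟨s, rfl⟩ := hz
  set K : Set ℝ := Icc s (s + 2 * π) ∩ p ⁻¹' (f '' sphere (0 : ℂ) 1) with hK
  have hcomp : IsCompact (f '' sphere (0 : ℂ) 1) := (isCompact_sphere _ _).image_of_continuousOn hc
  have hKc : IsCompact K := isCompact_Icc.inter_right (hcomp.isClosed.preimage hp.1)
  have hKi : InjOn p K := by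
    have hKs : K ⊆ Ico s (s + 2 * π) := by
      intro θ hθ
      refine ⟨hθ.1.1, lt_of_le_of_ne hθ.1.2 fun h => hzf ?_⟩
      rw [← hp.2.1 s, ← h]
      exact hθ.2
    exact (hp.injOn_Ico s).mono hKs
  have hKf : p '' K = f '' sphere (0 : ℂ) 1 := by
    refine Subset.antisymm (by rintro _ ⟨θ, hθ, rfl⟩; exact hθ.2) fun w hw => ?_
    obtain ⟨θ, rfl⟩ := hsub hw
    obtain ⟨θ', hθ', he⟩ := hp.2.1.exists_mem_Ico (by positivity : (0 : ℝ) < 2 * π) θ s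
    exact ⟨θ', ⟨Ico_subset_Icc_self hθ', by rw [mem_preimage, ← he]; exact hw⟩, he.symm⟩
  have hinv := hKc.continuousOn_invFunOn_image hp.1.continuousOn hKi
  rw [hKf] at hinv
  refine not_injOn_sphere_of_continuousOn (ψ := Function.invFunOn p K ∘ f)
    (hinv.comp hc (mapsTo_image _ _)) (InjOn.comp ?_ hi (mapsTo_image _ _))
  rw [← hKf]
  exact Function.invFunOn_injOn_image p K

theorem image_sphere_subset_of_isTQuasidisk {f : ℂ → ℂ} {Γ : Set ℂ} {x : ℂ}
    (hfc : ContinuousOn f (closedBall (0 : ℂ) 1)) (hfi : InjOn f (closedBall (0 : ℂ) 1))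
    (hf : f '' ball (0 : ℂ) 1 = connectedComponentIn Γᶜ x) :
    f '' sphere (0 : ℂ) 1 ⊆ Γ := by
  rintro _ ⟨z, hz, rfl⟩
  by_contra hzΓ
  have hzc := sphere_subset_closedBall hz
  have hcl : f z ∈ closure (connectedComponentIn Γᶜ x) := by
    rw [← hf]
    refine ContinuousWithinAt.mem_closure_image
      ((hfc z hzc).mono ball_subset_closedBall) ?_
    rwa [closure_ball _ one_ne_zero]
  have hne : (connectedComponentIn Γᶜ x).Nonempty := by
    rw [← hf]; exact ⟨f 0, mem_image_of_mem f (mem_ball_self one_pos)⟩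
  have hx : x ∈ Γᶜ := connectedComponentIn_nonempty_iff.1 hne
  have hpre : IsPreconnected (insert (f z) (connectedComponentIn Γᶜ x)) :=
    isPreconnected_connectedComponentIn.subset_closure (subset_insert _ _)
      (insert_subset hcl subset_closure)
  have h := hpre.subset_connectedComponentIn (mem_insert_of_mem _ (mem_connectedComponentIn hx))
    (insert_subset hzΓ (connectedComponentIn_subset _ _)) (mem_insert _ _)
  rw [← hf] at h
  obtain ⟨w, hw, hwz⟩ := h
  have := hfi (ball_subset_closedBall hw) hzc hwz
  subst this
  rw [mem_ball_zero_iff] at hw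
  rw [mem_sphere_zero_iff_norm] at hz
  exact hw.ne hz

theorem TQuasicircleCond.exists_isPreconnected {f : ℂ → ℂ} {Γ : Set ℂ} {t C : ℝ}
    (h : TQuasicircleCond t C Γ) (hc : ContinuousOn f (sphere (0 : ℂ) 1))
    (hi : InjOn f (sphere (0 : ℂ) 1)) (hf : f '' sphere (0 : ℂ) 1 = Γ) {z w : ℂ}
    (hz : z ∈ sphere (0 : ℂ) 1) (hw : w ∈ sphere (0 : ℂ) 1) :
    ∃ S ⊆ sphere (0 : ℂ) 1, IsPreconnected S ∧ z ∈ S ∧ w ∈ S ∧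
      ∀ u ∈ S, ∀ v ∈ S, dist (f u) (f v) ≤ C * dist (f z) (f w) ^ t := by
  obtain ⟨A, ⟨p, hp, hpΓ, a, b, hab, -, hpa, hpb, rfl⟩, hA⟩ :=
    h (f z) (hf ▸ mem_image_of_mem f hz) (f w) (hf ▸ mem_image_of_mem f hw)
  have hsub : p '' Icc a b ⊆ f '' sphere (0 : ℂ) 1 := by
    rw [hf, ← hpΓ]; exact image_subset_range _ _
  have hcont := ((isCompact_sphere (0 : ℂ) 1).continuousOn_invFunOn_image hc hi).mono hsub
  have hbdd : Bornology.IsBounded (p '' Icc a b) := (isCompact_Icc.image hp.1).isBounded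
  have hfA : ∀ u ∈ Function.invFunOn f (sphere (0 : ℂ) 1) '' (p '' Icc a b),
      f u ∈ p '' Icc a b := by
    rintro _ ⟨q, hq, rfl⟩
    rwa [Function.invFunOn_eq (hsub hq)]
  refine ⟨Function.invFunOn f (sphere (0 : ℂ) 1) '' (p '' Icc a b), ?_,
    (isPreconnected_Icc.image p hp.1.continuousOn).image _ hcont, ?_, ?_, fun u hu v hv => ?_⟩
  · rintro _ ⟨q, hq, rfl⟩
    exact Function.invFunOn_mem (hsub hq)
  · exact ⟨f z, ⟨a, left_mem_Icc.2 hab, hpa⟩, hi.leftInvOn_invFunOn hz⟩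
  · exact ⟨f w, ⟨b, right_mem_Icc.2 hab, hpb⟩, hi.leftInvOn_invFunOn hw⟩
  · exact (dist_le_diam_of_mem hbdd (hfA u hu) (hfA v hv)).trans hA

theorem IsPreconnected.mem_or_mem_of_im_neg_of_im_pos {S : Set ℂ} (hS : IsPreconnected S)
    (hS1 : S ⊆ sphere (0 : ℂ) 1) {z w u v : ℂ} (hz : z ∈ S) (hw : w ∈ S) (hu : ‖u‖ = 1)
    (hv : ‖v‖ = 1) (hneg : ((z - u) * starRingEnd ℂ (v - u)).im < 0)
    (hpos : 0 < ((w - u) * starRingEnd ℂ (v - u)).im) : u ∈ S ∨ v ∈ S := by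
  obtain ⟨q, hq, hq0⟩ : (0 : ℝ) ∈ (fun ζ : ℂ => ((ζ - u) * starRingEnd ℂ (v - u)).im) '' S :=
    hS.intermediate_value hz hw (by fun_prop) ⟨hneg.le, hpos.le⟩
  have hunit : ∀ c : ℂ, ‖c‖ = 1 → c * starRingEnd ℂ c = 1 := fun c hc => by
    rw [Complex.mul_conj, Complex.normSq_eq_norm_sq, hc]; norm_num
  have hq1 := hunit q (mem_sphere_zero_iff_norm.1 (hS1 hq))
  have hu1 := hunit u hu
  have hv1 := hunit v hv
  have hreal := Complex.conj_eq_iff_im.2 hq0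
  simp only [map_mul, map_sub, Complex.conj_conj] at hreal
  have hne : u ≠ v := by rintro rfl; simp at hneg
  have hprod : (q - u) * (u - v) * (q - v) = 0 := by
    have hkey : u * v * q * ((q - u) * (starRingEnd ℂ v - starRingEnd ℂ u)
        - (starRingEnd ℂ q - starRingEnd ℂ u) * (v - u)) = 0 := by
      rw [hreal]; ring
    linear_combination hkey - (q * u * (q - u)) * hv1 + (v * q * (q - u)) * hu1
      + (v - u) * u * v * hq1 - (v - u) * q * v * hu1
  rcases mul_eq_zero.1 hprod with h | h
  · rcases mul_eq_zero.1 h with h | h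
    · exact Or.inl (sub_eq_zero.1 h ▸ hq)
    · exact absurd (sub_eq_zero.1 h) hne
  · exact Or.inr (sub_eq_zero.1 h ▸ hq)

/-- The point of the unit circle at signed angle `σ * θ` from `x`. -/
noncomputable def circlePoint (x : ℂ) (σ θ : ℝ) : ℂ :=
  x * Complex.exp ((σ * θ : ℝ) * Complex.I)

theorem norm_circlePoint {x : ℂ} (hx : ‖x‖ = 1) (σ θ : ℝ) : ‖circlePoint x σ θ‖ = 1 := by
  rw [circlePoint, norm_mul, hx, Complex.norm_exp_ofReal_mul_I, one_mul]

theorem circlePoint_mem_sphere {x : ℂ} (hx : ‖x‖ = 1) (σ θ : ℝ) :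
    circlePoint x σ θ ∈ sphere (0 : ℂ) 1 :=
  mem_sphere_zero_iff_norm.2 (norm_circlePoint hx σ θ)

@[simp]
theorem circlePoint_zero (x : ℂ) (σ : ℝ) : circlePoint x σ 0 = x := by simp [circlePoint]

theorem circlePoint_pi (x : ℂ) {σ : ℝ} (hσ : σ = 1 ∨ σ = -1) : circlePoint x σ π = -x := by
  rcases hσ with rfl | rfl
  · simp [circlePoint]
  · simp [circlePoint, Complex.exp_neg]

theorem norm_circlePoint_sub {x : ℂ} (hx : ‖x‖ = 1) {σ : ℝ} (hσ : σ = 1 ∨ σ = -1) (θ φ : ℝ) :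
    ‖circlePoint x σ θ - circlePoint x σ φ‖ = 2 * |Real.sin ((θ - φ) / 2)| := by
  have h : circlePoint x σ θ - circlePoint x σ φ =
      circlePoint x σ φ * (Complex.exp (Complex.I * ((σ * (θ - φ) : ℝ) : ℂ)) - 1) := by
    rw [circlePoint, circlePoint, mul_sub, mul_assoc, ← Complex.exp_add, mul_one]
    congr 3; push_cast; ring
  rw [h, norm_mul, norm_circlePoint hx, one_mul, Complex.norm_exp_I_mul_ofReal_sub_one]
  rcases hσ with rfl | rfl
  · simp
  · rw [show -1 * (θ - φ) / 2 = -((θ - φ) / 2) by ring, Real.sin_neg]; simp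

theorem circlePoint_sq_mul_conj {x : ℂ} (hx : ‖x‖ = 1) (σ μ τ : ℝ) :
    circlePoint x σ μ ^ 2 * starRingEnd ℂ (circlePoint x σ (μ - τ)) =
      circlePoint x σ (μ + τ) := by
  have hxx : x * starRingEnd ℂ x = 1 := by
    rw [Complex.mul_conj, Complex.normSq_eq_norm_sq, hx]; norm_num
  simp only [circlePoint, map_mul, ← Complex.exp_conj, mul_pow, ← Complex.exp_nat_mul,
    Complex.conj_ofReal, Complex.conj_I]
  calc _ = x * (x * starRingEnd ℂ x) * (Complex.exp ((2 : ℕ) * ((σ * μ : ℝ) * Complex.I)) *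
        Complex.exp ((σ * (μ - τ) : ℝ) * -Complex.I)) := by ring
    _ = _ := by
      rw [hxx, mul_one, ← Complex.exp_add]
      congr 2; push_cast; ring

theorem im_circlePoint_sub_mul_conj {x : ℂ} (hx : ‖x‖ = 1) {σ : ℝ} (hσ : σ = 1 ∨ σ = -1)
    (θ φ ψ : ℝ) :
    ((circlePoint x σ θ - circlePoint x σ φ) *
      starRingEnd ℂ (circlePoint x σ ψ - circlePoint x σ φ)).im =
      σ * (4 * Real.sin ((θ - φ) / 2) * Real.sin ((ψ - φ) / 2) * Real.sin ((θ - ψ) / 2)) := by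
  have hxx : x * starRingEnd ℂ x = 1 := by
    rw [Complex.mul_conj, Complex.normSq_eq_norm_sq, hx]; norm_num
  have h1 : (circlePoint x σ θ - circlePoint x σ φ) *
      starRingEnd ℂ (circlePoint x σ ψ - circlePoint x σ φ) =
      (Complex.exp ((σ * θ : ℝ) * Complex.I) - Complex.exp ((σ * φ : ℝ) * Complex.I)) *
      starRingEnd ℂ (Complex.exp ((σ * ψ : ℝ) * Complex.I) -
        Complex.exp ((σ * φ : ℝ) * Complex.I)) := by
    simp only [circlePoint, map_mul, ← mul_sub]
    linear_combination ((Complex.exp ((σ * θ : ℝ) * Complex.I) -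
      Complex.exp ((σ * φ : ℝ) * Complex.I)) *
      starRingEnd ℂ (Complex.exp ((σ * ψ : ℝ) * Complex.I) -
        Complex.exp ((σ * φ : ℝ) * Complex.I))) * hxx
  have hsc : ∀ y : ℝ, Real.sin (σ * y) = σ * Real.sin y ∧ Real.cos (σ * y) = Real.cos y :=
    fun y => by rcases hσ with rfl | rfl <;> simp
  rw [h1, Complex.mul_im]
  simp only [Complex.sub_re, Complex.sub_im, Complex.conj_re, Complex.conj_im,
    Complex.exp_ofReal_mul_I_re, Complex.exp_ofReal_mul_I_im, (hsc _).1, (hsc _).2]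
  have htrig : ∀ a b : ℝ, Real.sin (2 * (a - b)) - Real.sin (2 * a) + Real.sin (2 * b) =
      4 * Real.sin a * Real.sin b * Real.sin (a - b) := fun a b => by
    rw [Real.sin_two_mul, Real.sin_two_mul, Real.sin_two_mul, Real.sin_sub, Real.cos_sub]
    linear_combination 2 * Real.sin a * Real.cos a * Real.sin_sq_add_cos_sq b -
      2 * Real.sin b * Real.cos b * Real.sin_sq_add_cos_sq a
  have h2 := htrig ((θ - φ) / 2) ((ψ - φ) / 2)
  rw [show (θ - φ) / 2 - (ψ - φ) / 2 = (θ - ψ) / 2 by ring,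
    show 2 * ((θ - ψ) / 2) = θ - ψ by ring, show 2 * ((θ - φ) / 2) = θ - φ by ring,
    show 2 * ((ψ - φ) / 2) = ψ - φ by ring, Real.sin_sub, Real.sin_sub, Real.sin_sub] at h2
  rw [← h2]
  ring

/-- The `t`-quasicircle condition in terms of four interlaced points of the unit circle: one of the
two arcs from `θ₁` to `θ₂` is mapped to a set of diameter at most `C * |f(θ₁) - f(θ₂)| ^ t`. -/
theorem TQuasicircleCond.dist_le_or_dist_le {f : ℂ → ℂ} {Γ : Set ℂ} {t C : ℝ}
    (h : TQuasicircleCond t C Γ) (hc : ContinuousOn f (sphere (0 : ℂ) 1))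
    (hi : InjOn f (sphere (0 : ℂ) 1)) (hf : f '' sphere (0 : ℂ) 1 = Γ) {x : ℂ} (hx : ‖x‖ = 1)
    {σ : ℝ} (hσ : σ = 1 ∨ σ = -1) {θ₁ φ θ₂ ψ : ℝ} (h₁ : θ₁ < φ) (h₂ : φ < θ₂) (h₃ : θ₂ < ψ)
    (h₄ : ψ < θ₁ + 2 * π) {θ : ℝ} (hθ : θ = θ₁ ∨ θ = θ₂) :
    dist (f (circlePoint x σ φ)) (f (circlePoint x σ θ)) ≤
        C * dist (f (circlePoint x σ θ₁)) (f (circlePoint x σ θ₂)) ^ t ∨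
      dist (f (circlePoint x σ ψ)) (f (circlePoint x σ θ)) ≤
        C * dist (f (circlePoint x σ θ₁)) (f (circlePoint x σ θ₂)) ^ t := by
  obtain ⟨S, hS1, hS, hz, hw, hd⟩ := h.exists_isPreconnected hc hi hf
    (circlePoint_mem_sphere hx σ θ₁) (circlePoint_mem_sphere hx σ θ₂)
  have hθS : circlePoint x σ θ ∈ S := by rcases hθ with rfl | rfl <;> assumption
  have a1 : Real.sin ((θ₁ - φ) / 2) < 0 := Real.sin_neg_of_neg_of_neg_pi_lt (by linarith) (by linarith)
  have a2 : 0 < Real.sin ((ψ - φ) / 2) := Real.sin_pos_of_pos_of_lt_pi (by linarith) (by linarith)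
  have a3 : Real.sin ((θ₁ - ψ) / 2) < 0 := Real.sin_neg_of_neg_of_neg_pi_lt (by linarith) (by linarith)
  have a4 : 0 < Real.sin ((θ₂ - φ) / 2) := Real.sin_pos_of_pos_of_lt_pi (by linarith) (by linarith)
  have a5 : Real.sin ((θ₂ - ψ) / 2) < 0 := Real.sin_neg_of_neg_of_neg_pi_lt (by linarith) (by linarith)
  have b1 : 0 < 4 * Real.sin ((θ₁ - φ) / 2) * Real.sin ((ψ - φ) / 2) * Real.sin ((θ₁ - ψ) / 2) :=
    mul_pos_of_neg_of_neg (by nlinarith) a3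
  have b2 : 4 * Real.sin ((θ₂ - φ) / 2) * Real.sin ((ψ - φ) / 2) * Real.sin ((θ₂ - ψ) / 2) < 0 :=
    mul_neg_of_pos_of_neg (by positivity) a5
  have key : circlePoint x σ φ ∈ S ∨ circlePoint x σ ψ ∈ S := by
    have c1 := im_circlePoint_sub_mul_conj hx hσ θ₁ φ ψ
    have c2 := im_circlePoint_sub_mul_conj hx hσ θ₂ φ ψ
    rcases hσ with rfl | rfl
    · exact hS.mem_or_mem_of_im_neg_of_im_pos hS1 hw hz (norm_circlePoint hx _ _)
        (norm_circlePoint hx _ _) (by rw [c2]; linarith) (by rw [c1]; linarith)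
    · exact hS.mem_or_mem_of_im_neg_of_im_pos hS1 hz hw (norm_circlePoint hx _ _)
        (norm_circlePoint hx _ _) (by rw [c1]; linarith) (by rw [c2]; linarith)
  exact key.imp (fun hk => hd _ hk _ hθS) fun hk => hd _ hk _ hθS
theorem exists_pos_le_dist_of_injOn {X Y : Type*} [PseudoMetricSpace X] [MetricSpace Y] {f : X → Y}
    {K : Set X} (hK : IsCompact K) (hc : ContinuousOn f K) (hi : InjOn f K) {δ : ℝ} (hδ : 0 < δ) :
    ∃ c > 0, ∀ u ∈ K, ∀ v ∈ K, δ ≤ dist u v → c ≤ dist (f u) (f v) := by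
  set S : Set (X × X) := (K ×ˢ K) ∩ {p | δ ≤ dist p.1 p.2} with hS
  have hSc : IsCompact S := (hK.prod hK).inter_right (isClosed_le continuous_const continuous_dist)
  have hd : ContinuousOn (fun p : X × X => dist (f p.1) (f p.2)) S :=
    continuous_dist.comp_continuousOn ((hc.comp (t := K) continuousOn_fst fun _ hp => hp.1.1).prodMk
      (hc.comp (t := K) continuousOn_snd fun _ hp => hp.1.2))
  rcases S.eq_empty_or_nonempty with h | h
  · refine ⟨1, one_pos, fun u hu v hv huv => absurd (h ▸ ?_ : (u, v) ∈ (∅ : Set (X × X)))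
      (notMem_empty _)⟩
    exact ⟨⟨hu, hv⟩, huv⟩
  · obtain ⟨p, hp, hmin⟩ := hSc.exists_isMinOn h hd
    refine ⟨dist (f p.1) (f p.2), dist_pos.2 fun hf => ?_, fun u hu v hv huv =>
      hmin (show (u, v) ∈ S from ⟨⟨hu, hv⟩, huv⟩)⟩
    have h0 := hp.2
    have h1 := hi hp.1.1 hp.1.2 hf
    change δ ≤ dist p.1 p.2 at h0
    rw [h1, dist_self] at h0
    exact h0.not_gt hδ

theorem exists_circlePoint_eq {x z : ℂ} (hx : ‖x‖ = 1) (hz : ‖z‖ = 1) {σ : ℝ}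
    (hσ : σ = 1 ∨ σ = -1) : ∃ B : ℝ, |B| ≤ π ∧ circlePoint x σ B = z ∧
      B = σ * Complex.arg (z / x) := by
  have hx0 : x ≠ 0 := norm_ne_zero_iff.1 (hx ▸ one_ne_zero)
  have hσσ : σ * σ = 1 := by rcases hσ with rfl | rfl <;> norm_num
  refine ⟨σ * Complex.arg (z / x), ?_, ?_, rfl⟩
  · have : |σ| = 1 := by rcases hσ with rfl | rfl <;> norm_num
    rw [abs_mul, this, one_mul]
    exact Complex.abs_arg_le_pi _
  · have h := Complex.norm_mul_exp_arg_mul_I (z / x)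
    rw [norm_div, hx, hz, div_one, Complex.ofReal_one, one_mul] at h
    rw [circlePoint, ← mul_assoc, hσσ, one_mul, h, mul_div_cancel₀ _ hx0]

theorem exists_circlePoint_eq_of_ne {x z : ℂ} (hx : ‖x‖ = 1) (hz : ‖z‖ = 1) (hxz : z ≠ x) :
    ∃ σ A : ℝ, (σ = 1 ∨ σ = -1) ∧ 0 < A ∧ A ≤ π ∧ circlePoint x σ A = z := by
  have h0 : ∀ σ : ℝ, (σ = 1 ∨ σ = -1) → 0 ≤ σ * Complex.arg (z / x) →
      ∃ σ A : ℝ, (σ = 1 ∨ σ = -1) ∧ 0 < A ∧ A ≤ π ∧ circlePoint x σ A = z := by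
    intro σ hσ hnn
    obtain ⟨A, hA, hAz, hAe⟩ := exists_circlePoint_eq hx hz hσ
    refine ⟨σ, A, hσ, lt_of_le_of_ne (hAe ▸ hnn) ?_, (abs_le.1 hA).2, hAz⟩
    rintro rfl
    exact hxz (by rw [← hAz, circlePoint_zero])
  rcases le_total 0 (Complex.arg (z / x)) with h | h
  · exact h0 1 (Or.inl rfl) (by linarith)
  · exact h0 (-1) (Or.inr rfl) (by linarith)

theorem one_add_mul_sin_le_sin_add {K u h : ℝ} (hK : 1 ≤ K) (hu : 0 ≤ u) (hh : 0 ≤ h)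
    (huh : u + h ≤ 3 / 4) (hKh : u ≤ K * h) :
    (1 + 1 / (4 * K)) * Real.sin u ≤ Real.sin (u + h) := by
  have h1 := Real.sin_sub_sin (u + h) u
  have h2 : h / 4 ≤ Real.sin ((u + h - u) / 2) := by
    have h3 := Real.mul_le_sin (x := h / 2) (by linarith) (by linarith [Real.pi_gt_three])
    have h4 : (1 : ℝ) / 2 ≤ 2 / π := by
      rw [div_le_div_iff₀ two_pos Real.pi_pos]; linarith [Real.pi_le_four]
    rw [show (u + h - u) / 2 = h / 2 by ring]
    nlinarith
  have h5 : (1 : ℝ) / 2 ≤ Real.cos ((u + h + u) / 2) := by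
    have := Real.one_sub_sq_div_two_le_cos (x := (u + h + u) / 2)
    nlinarith
  have h6 : h / 4 ≤ Real.sin (u + h) - Real.sin u := by
    rw [h1]; nlinarith
  have h7 := Real.sin_le hu
  have h8 : 1 / (4 * K) * Real.sin u ≤ h / 4 := by
    rw [div_mul_eq_mul_div, one_mul, div_le_iff₀ (by positivity)]
    nlinarith
  linarith

theorem TQuasicircleCond.dist_circlePoint_le {f : ℂ → ℂ} {Γ : Set ℂ} {t C c D : ℝ}
    (h : TQuasicircleCond t C Γ) (hc : ContinuousOn f (sphere (0 : ℂ) 1))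
    (hi : InjOn f (sphere (0 : ℂ) 1)) (hf : f '' sphere (0 : ℂ) 1 = Γ) (hC : 0 ≤ C) (hc0 : 0 < c)
    (hcD : c ≤ D) (hanti : ∀ u ∈ sphere (0 : ℂ) 1, c ≤ dist (f (-u)) (f u))
    (hdiam : ∀ u ∈ sphere (0 : ℂ) 1, ∀ v ∈ sphere (0 : ℂ) 1, dist (f u) (f v) ≤ D)
    {x : ℂ} (hx : ‖x‖ = 1) {σ : ℝ} (hσ : σ = 1 ∨ σ = -1) {B θ : ℝ} (hB : |B| < π)
    (hθ : 0 < θ ∧ θ < B ∨ B < θ ∧ θ < 0) :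
    dist (f (circlePoint x σ θ)) (f x) ≤ D * C / c * dist (f (circlePoint x σ B)) (f x) ^ t := by
  have hxs : x ∈ sphere (0 : ℂ) 1 := mem_sphere_zero_iff_norm.2 hx
  obtain ⟨hB1, hB2⟩ := abs_lt.1 hB
  have key : dist (f (circlePoint x σ θ)) (f x) ≤
        C * dist (f (circlePoint x σ B)) (f x) ^ t ∨
      dist (f (-x)) (f x) ≤ C * dist (f (circlePoint x σ B)) (f x) ^ t := by
    rcases hθ with ⟨h1, h2⟩ | ⟨h1, h2⟩
    · have := h.dist_le_or_dist_le hc hi hf hx hσ h1 h2 hB2 (by linarith) (Or.inl rfl)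
      rwa [circlePoint_pi x hσ, circlePoint_zero, dist_comm (f x)] at this
    · have := h.dist_le_or_dist_le hc hi hf hx hσ h1 h2 Real.pi_pos (by linarith) (Or.inr rfl)
      rwa [circlePoint_pi x hσ, circlePoint_zero] at this
  have hr : 0 ≤ C * dist (f (circlePoint x σ B)) (f x) ^ t := by positivity
  rw [mul_div_right_comm, mul_assoc]
  rcases key with h1 | h1
  · exact h1.trans (le_mul_of_one_le_left hr ((one_le_div hc0).2 hcD))
  · have h2 := (hanti x hxs).trans h1
    refine (hdiam _ (circlePoint_mem_sphere hx σ θ) x hxs).trans ?_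
    rw [div_mul_eq_mul_div, le_div_iff₀ hc0]
    exact mul_le_mul_of_nonneg_left h2 (hc0.le.trans hcD)

theorem TQuasicircleCond.dist_le_dist_circlePoint {f : ℂ → ℂ} {Γ : Set ℂ} {t C c D : ℝ}
    (h : TQuasicircleCond t C Γ) (hc : ContinuousOn f (sphere (0 : ℂ) 1))
    (hi : InjOn f (sphere (0 : ℂ) 1)) (hf : f '' sphere (0 : ℂ) 1 = Γ) (hC : 0 ≤ C) (hc0 : 0 < c)
    (hcD : c ≤ D) (hanti : ∀ u ∈ sphere (0 : ℂ) 1, c ≤ dist (f (-u)) (f u))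
    (hdiam : ∀ u ∈ sphere (0 : ℂ) 1, ∀ v ∈ sphere (0 : ℂ) 1, dist (f u) (f v) ≤ D)
    {x : ℂ} (hx : ‖x‖ = 1) {σ : ℝ} (hσ : σ = 1 ∨ σ = -1) {A θ : ℝ} (hA : 0 < A) (hAθ : A < θ)
    (hθ : θ < π) :
    dist (f (circlePoint x σ A)) (f x) ≤ D * C / c * dist (f (circlePoint x σ θ)) (f x) ^ t := by
  have hxs : x ∈ sphere (0 : ℂ) 1 := mem_sphere_zero_iff_norm.2 hx
  have key := h.dist_le_or_dist_le hc hi hf hx hσ hA hAθ hθ (by linarith) (Or.inl rfl)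
  rw [circlePoint_pi x hσ, circlePoint_zero, dist_comm (f x)] at key
  have hr : 0 ≤ C * dist (f (circlePoint x σ θ)) (f x) ^ t := by positivity
  rw [mul_div_right_comm, mul_assoc]
  rcases key with h1 | h1
  · exact h1.trans (le_mul_of_one_le_left hr ((one_le_div hc0).2 hcD))
  · have h2 := (hanti x hxs).trans h1
    refine (hdiam _ (circlePoint_mem_sphere hx σ A) x hxs).trans ?_
    rw [div_mul_eq_mul_div, le_div_iff₀ hc0]
    exact mul_le_mul_of_nonneg_left h2 (hc0.le.trans hcD)

theorem exists_two_mul_sin_half_eq {τ₁ τ₂ ρ : ℝ} (h : τ₁ ≤ τ₂)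
    (hρ : ρ ∈ Ioo (2 * Real.sin (τ₁ / 2)) (2 * Real.sin (τ₂ / 2))) :
    ∃ τ ∈ Ioo τ₁ τ₂, 2 * Real.sin (τ / 2) = ρ :=
  intermediate_value_Ioo h (f := fun τ => 2 * Real.sin (τ / 2)) (by fun_prop) hρ
theorem le_exp_mul_of_mem_arcs {f : ℂ → ℂ} (hfc : ContinuousOn f (closedBall (0 : ℂ) 1))
    (hfd : DifferentiableOn ℂ f (ball (0 : ℂ) 1)) (hfi : InjOn f (closedBall (0 : ℂ) 1))
    {x w : ℂ} (hx : ‖x‖ = 1) {σ : ℝ} (hσ : σ = 1 ∨ σ = -1) {A B K r R : ℝ} (hA : A ≤ 1)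
    (hK : 1 ≤ K) (hB : B ≠ 0) (hBA : |B| ≤ A) (hne : B ≠ A) (hAB : A ≤ 2 * K * |B|) (hr : 0 < r)
    (hnear : ∀ θ, 0 < θ ∧ θ < B ∨ B < θ ∧ θ < 0 → dist (f (circlePoint x σ θ)) w ≤ r)
    (hfar : ∀ θ, A < θ → θ < π → R ≤ dist (f (circlePoint x σ θ)) w) :
    R ≤ Real.exp (2 * π ^ 2 / Real.log (1 + 1 / (4 * K))) * r := by
  have hK' : 0 < 1 / (4 * K) := by positivity
  have hlog : 0 < Real.log (1 + 1 / (4 * K)) := Real.log_pos (by linarith)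
  rcases le_or_gt R r with hRr | hrR
  · exact hRr.trans (le_mul_of_one_le_left hr.le (Real.one_le_exp (by positivity)))
  have hB0 : 0 < |B| := abs_pos.2 hB
  obtain ⟨τ, hτ0, hτA, hτ⟩ : ∃ τ, 0 < τ ∧ τ ≤ A / 2 ∧
      (0 < B ∧ A - 2 * τ = B ∨ B < 0 ∧ A - 2 * τ = 0) := by
    rcases hB.lt_or_gt with h | h
    · exact ⟨A / 2, by linarith, le_rfl, Or.inr ⟨h, by ring⟩⟩
    · rw [abs_of_pos h] at hBA
      exact ⟨(A - B) / 2, by linarith [lt_of_le_of_ne hBA hne], by linarith, Or.inl ⟨h, by ring⟩⟩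
  have hπ := Real.pi_gt_three
  have hsin : 0 < Real.sin (τ / 2) := Real.sin_pos_of_pos_of_lt_pi (by linarith) (by linarith)
  have hratio := one_add_mul_sin_le_sin_add (K := K) (u := τ / 2) (h := |B| / 2) hK
    (by linarith) (by linarith) (by linarith) (by linarith)
  rw [show τ / 2 + |B| / 2 = (τ + |B|) / 2 by ring] at hratio
  have hρ : 2 * Real.sin (τ / 2) < 2 * Real.sin ((τ + |B|) / 2) := by nlinarith
  have hmain := log_div_mul_log_div_le hfc hfd hfi (m := circlePoint x σ (A - τ)) (w₀ := w)
    (norm_circlePoint hx σ _) hr hrR (by linarith : 0 < 2 * Real.sin (τ / 2)) hρ ?_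
  · have h1 : Real.log (1 + 1 / (4 * K)) ≤
        Real.log (2 * Real.sin ((τ + |B|) / 2) / (2 * Real.sin (τ / 2))) := by
      refine Real.log_le_log (by positivity) ?_
      rw [le_div_iff₀ (by positivity)]
      linarith
    have h2 : 0 < Real.log (R / r) := Real.log_pos ((one_lt_div hr).2 hrR)
    have h3 : Real.log (R / r) ≤ 2 * π ^ 2 / Real.log (1 + 1 / (4 * K)) := by
      rw [le_div_iff₀ hlog]
      exact (mul_le_mul_of_nonneg_left h1 h2.le).trans hmain
    rwa [Real.log_le_iff_le_exp (div_pos (hr.trans hrR) hr), div_le_iff₀ hr] at h3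
  · intro ρ hρm
    obtain ⟨s, ⟨hs1, hs2⟩, rfl⟩ := exists_two_mul_sin_half_eq (by linarith) hρm
    refine ⟨circlePoint x σ (A - τ - s), norm_circlePoint hx σ _, ?_, ?_, ?_⟩
    · rw [norm_circlePoint_sub hx hσ, show (A - τ - s - (A - τ)) / 2 = -(s / 2) by ring,
        Real.sin_neg, abs_neg, abs_of_pos]
      exact Real.sin_pos_of_pos_of_lt_pi (by linarith) (by linarith)
    · rw [← dist_eq_norm]
      refine hnear _ ?_
      rcases hτ with ⟨h, hτ⟩ | ⟨h, hτ⟩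
      · rw [abs_of_pos h] at hs2
        exact Or.inl ⟨by linarith, by linarith⟩
      · rw [abs_of_neg h] at hs2
        exact Or.inr ⟨by linarith, by linarith⟩
    · rw [← dist_eq_norm, circlePoint_sq_mul_conj hx]
      exact hfar _ (by linarith) (by linarith)

theorem rpow_le_mul_rpow_sq {t G Q r R : ℝ} (ht : 0 < t) (ht1 : t ≤ 1) (hG : 1 ≤ G) (hQ : 1 ≤ Q)
    (hr : 0 ≤ r) (hR : 0 ≤ R) (h : (R / G) ^ t⁻¹ ≤ Q * (G * r ^ t)) :
    R ≤ Q * G ^ 2 * r ^ (t ^ 2) := by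
  have hG0 : 0 < G := by linarith
  have h1 : R / G ≤ (Q * (G * r ^ t)) ^ t := by
    rw [← Real.rpow_inv_rpow (div_nonneg hR hG0.le) ht.ne']
    exact Real.rpow_le_rpow (by positivity) h ht.le
  rw [← mul_assoc, Real.mul_rpow (by positivity) (by positivity), ← Real.rpow_mul hr, ← sq] at h1
  have h2 : (Q * G) ^ t ≤ Q * G := Real.rpow_le_self_of_one_le (by nlinarith) ht1
  rw [div_le_iff₀ hG0] at h1
  calc R ≤ (Q * G) ^ t * r ^ (t ^ 2) * G := h1
    _ ≤ (Q * G) * r ^ (t ^ 2) * G := by gcongr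
    _ = _ := by ring

theorem exists_dist_le_mul_rpow_of_le {f : ℂ → ℂ} {Γ : Set ℂ} {t C : ℝ} (ht : 0 < t) (ht1 : t ≤ 1)
    (hC : 1 ≤ C) (h : TQuasicircleCond t C Γ) (hfc : ContinuousOn f (closedBall (0 : ℂ) 1))
    (hfd : DifferentiableOn ℂ f (ball (0 : ℂ) 1)) (hfi : InjOn f (closedBall (0 : ℂ) 1))
    (hf : f '' sphere (0 : ℂ) 1 = Γ) {K : ℝ} (hK : 1 ≤ K) :
    ∃ M, 0 ≤ M ∧ ∀ a ∈ sphere (0 : ℂ) 1, ∀ b ∈ sphere (0 : ℂ) 1, ∀ x ∈ sphere (0 : ℂ) 1,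
      ∀ k : ℝ, 1 ≤ k → k ≤ K → dist a x = k * dist x b →
        dist (f a) (f x) ≤ M * dist (f b) (f x) ^ (t ^ 2) := by
  have hc := hfc.mono sphere_subset_closedBall
  have hi := hfi.mono sphere_subset_closedBall
  have hS := isCompact_sphere (0 : ℂ) 1
  obtain ⟨c, hc0, hanti'⟩ := exists_pos_le_dist_of_injOn hS hc hi two_pos
  obtain ⟨e, he0, he⟩ := exists_pos_le_dist_of_injOn hS hc hi (δ := 1 / (2 * K)) (by positivity)
  have hanti : ∀ u ∈ sphere (0 : ℂ) 1, c ≤ dist (f (-u)) (f u) := fun u hu => by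
    have hu1 := mem_sphere_zero_iff_norm.1 hu
    refine hanti' _ (mem_sphere_zero_iff_norm.2 (by rw [norm_neg, hu1])) u hu (le_of_eq ?_)
    rw [dist_eq_norm, show -u - u = -2 * u by ring, norm_mul, hu1]
    norm_num
  obtain ⟨D, hcD, hD1, hdiam⟩ : ∃ D, c ≤ D ∧ 1 ≤ D ∧
      ∀ u ∈ sphere (0 : ℂ) 1, ∀ v ∈ sphere (0 : ℂ) 1, dist (f u) (f v) ≤ D := by
    refine ⟨max (max c 1) (diam (f '' sphere (0 : ℂ) 1)), ?_, ?_, fun u hu v hv => ?_⟩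
    · exact (le_max_left _ _).trans (le_max_left _ _)
    · exact (le_max_right _ _).trans (le_max_left _ _)
    · exact (dist_le_diam_of_mem (hS.image_of_continuousOn hc).isBounded
        (mem_image_of_mem f hu) (mem_image_of_mem f hv)).trans (le_max_right _ _)
  have ht2 : 0 < t ^ 2 := by positivity
  have ht21 : t ^ 2 ≤ 1 := pow_le_one₀ ht.le ht1
  have hG : 1 ≤ D * C / c := by
    exact (one_le_div hc0).2 (hcD.trans (le_mul_of_one_le_right (by linarith) hC))
  have hlog : 0 < Real.log (1 + 1 / (4 * K)) :=
    Real.log_pos (by linarith [show 0 < 1 / (4 * K) by positivity])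
  set G := D * C / c
  set Q := Real.exp (2 * π ^ 2 / Real.log (1 + 1 / (4 * K)))
  have hQ : 1 ≤ Q := Real.one_le_exp (by positivity)
  refine ⟨D / e ^ (t ^ 2) + D + Q * G ^ 2, by positivity, ?_⟩
  intro a ha b hb x hx k hk1 hkK hd
  have ha1 := mem_sphere_zero_iff_norm.1 ha
  have hb1 := mem_sphere_zero_iff_norm.1 hb
  have hx1 := mem_sphere_zero_iff_norm.1 hx
  have hr0 : 0 ≤ dist (f b) (f x) ^ (t ^ 2) := by positivity
  have hk0 : 0 < k := by linarith
  suffices hsuff : dist (f a) (f x) ≤ D / e ^ (t ^ 2) * dist (f b) (f x) ^ (t ^ 2) ∨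
      dist (f a) (f x) ≤ D * dist (f b) (f x) ^ (t ^ 2) ∨
      dist (f a) (f x) ≤ Q * G ^ 2 * dist (f b) (f x) ^ (t ^ 2) by
    have h1 : 0 ≤ D / e ^ (t ^ 2) * dist (f b) (f x) ^ (t ^ 2) := by positivity
    have h2 : 0 ≤ D * dist (f b) (f x) ^ (t ^ 2) := by positivity
    have h3 : 0 ≤ Q * G ^ 2 * dist (f b) (f x) ^ (t ^ 2) := by positivity
    rw [add_mul, add_mul]
    rcases hsuff with h' | h' | h' <;> linarith
  rcases le_or_gt (1 / 2) (dist a x) with hlarge | hsmall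
  · left
    have h1 : 1 / (2 * K) ≤ dist b x := by
      rw [dist_comm b x, div_le_iff₀ (by positivity)]
      nlinarith [dist_nonneg (x := x) (y := b)]
    have h2 := he b hb x hx h1
    have h3 : e ^ (t ^ 2) ≤ dist (f b) (f x) ^ (t ^ 2) := Real.rpow_le_rpow he0.le h2 ht2.le
    refine (hdiam a ha x hx).trans ?_
    rw [div_mul_eq_mul_div, le_div_iff₀ (by positivity)]
    exact mul_le_mul_of_nonneg_left h3 (by linarith)
  by_cases hax : a = x
  · right; left
    rw [hax, dist_self]
    positivity
  right
  obtain ⟨σ, A, hσ, hA0, hAπ, rfl⟩ := exists_circlePoint_eq_of_ne hx1 ha1 hax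
  obtain ⟨B, hBπ, rfl, -⟩ := exists_circlePoint_eq hx1 hb1 hσ
  have hdA : dist (circlePoint x σ A) x = 2 * Real.sin (A / 2) := by
    have h1 := norm_circlePoint_sub hx1 hσ A 0
    rwa [circlePoint_zero, sub_zero, ← dist_eq_norm, abs_of_pos
      (Real.sin_pos_of_pos_of_lt_pi (by linarith) (by linarith [Real.pi_pos]))] at h1
  have hdB : dist x (circlePoint x σ B) = 2 * Real.sin (|B| / 2) := by
    have h1 := norm_circlePoint_sub hx1 hσ B 0
    rw [circlePoint_zero, sub_zero, ← dist_eq_norm, dist_comm] at h1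
    rw [h1]
    congr 1
    have hB2 : |B / 2| = |B| / 2 := by rw [abs_div, abs_two]
    rw [Real.abs_sin_eq_sin_abs_of_abs_le_pi (by linarith [abs_nonneg B]), hB2]
  rw [hdA, hdB] at hd
  rw [hdA] at hsmall
  have hπ3 := Real.pi_gt_three
  have hπ4 := Real.pi_le_four
  have hinv : (1 : ℝ) / 2 ≤ 2 / π := by rw [div_le_div_iff₀ two_pos Real.pi_pos]; linarith
  have hjA := Real.mul_le_sin (x := A / 2) (by linarith) (by linarith)
  have hjA' : A / 4 ≤ Real.sin (A / 2) := by nlinarith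
  have hA1 : A ≤ 1 := by linarith
  have hsA : 0 < Real.sin (A / 2) := by linarith
  have hsB : Real.sin (|B| / 2) ≤ |B| / 2 := Real.sin_le (by positivity)
  have hAB : A ≤ 2 * K * |B| := by
    have : k * Real.sin (|B| / 2) ≤ K * (|B| / 2) :=
      mul_le_mul hkK hsB (Real.sin_nonneg_of_nonneg_of_le_pi (by positivity) (by linarith))
        (by linarith)
    linarith
  have hBpos : 0 < |B| := by
    by_contra hB
    rw [le_antisymm (not_lt.1 hB) (abs_nonneg B), mul_zero] at hAB
    linarith
  have hBA : |B| ≤ A := by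
    by_contra! hlt
    have h1 : Real.sin (A / 2) < Real.sin (|B| / 2) :=
      Real.sin_lt_sin_of_lt_of_le_pi_div_two (by linarith) (by linarith) (by linarith)
    have h2 : Real.sin (|B| / 2) ≤ k * Real.sin (|B| / 2) :=
      le_mul_of_one_le_left (by linarith) hk1
    linarith
  rcases eq_or_ne B A with rfl | hne
  · left
    have hr := hdiam _ ha x hx
    set r := dist (f (circlePoint x σ B)) (f x)
    rcases le_or_gt r 1 with h1 | h1
    · have h2 := Real.rpow_le_rpow_of_exponent_ge' (x := r) dist_nonneg h1 ht2.le ht21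
      rw [Real.rpow_one] at h2
      exact h2.trans (le_mul_of_one_le_left (by positivity) hD1)
    · exact hr.trans (le_mul_of_one_le_right (by linarith) (Real.one_le_rpow h1.le ht2.le))
  right
  have hxb : circlePoint x σ B ≠ x := by
    intro hxb
    rw [hxb, dist_self] at hdB
    rw [← hdB, mul_zero] at hd
    linarith
  have hr : 0 < dist (f (circlePoint x σ B)) (f x) :=
    dist_pos.2 fun h' => hxb (hi hb hx h')
  have hG0 : 0 < G := by linarith
  refine rpow_le_mul_rpow_sq ht ht1 hG hQ dist_nonneg dist_nonneg ?_
  refine le_exp_mul_of_mem_arcs hfc hfd hfi hx1 hσ hA1 hK (abs_pos.1 hBpos) hBA hne hAB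
    (w := f x) (by positivity) (fun θ hθ => ?_) (fun θ hAθ hθ => ?_)
  · exact h.dist_circlePoint_le hc hi hf (by linarith) hc0 hcD hanti hdiam hx1 hσ
      (by linarith) hθ
  · have h1 := h.dist_le_dist_circlePoint hc hi hf (by linarith) hc0 hcD hanti hdiam hx1 hσ
      hA0 hAθ hθ
    rw [mul_comm, ← div_le_iff₀ hG0] at h1
    rw [Real.rpow_inv_le_iff_of_pos (by positivity) dist_nonneg ht]
    exact h1

/-- Let `Ω` be a `t`-quasidisk and `f` a conformal map of `𝔻` onto `Ω` with induced
boundary values `f : 𝕋 → ∂Ω`.  Then there is a strictly increasing function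
`η : [0,∞) → [0,∞)` such that for all `a, b, x ∈ 𝕋` and `k ≥ 1`, if `|a−x| = k·|x−b|`
then `|f(a) − f(x)| ≤ η(k)·|f(b) − f(x)|^(t²)`. -/
theorem stmt15 (t : ℝ) (ht : 0 < t) (ht1 : t ≤ 1) (Γ Ω : Set ℂ) (f : ℂ → ℂ)
    (hΩ : IsTQuasidisk t Γ Ω)
    (hfc : ContinuousOn f (Metric.closedBall (0 : ℂ) 1))
    (hfd : DifferentiableOn ℂ f (Metric.ball (0 : ℂ) 1))
    (hfi : Set.InjOn f (Metric.closedBall (0 : ℂ) 1))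
    (hfΩ : f '' Metric.ball (0 : ℂ) 1 = Ω) :
    ∃ η : ℝ → ℝ, StrictMonoOn η (Set.Ici 0) ∧ (∀ k : ℝ, 0 ≤ k → 0 ≤ η k) ∧
      ∀ a ∈ Metric.sphere (0 : ℂ) 1, ∀ b ∈ Metric.sphere (0 : ℂ) 1,
        ∀ x ∈ Metric.sphere (0 : ℂ) 1, ∀ k : ℝ, 1 ≤ k →
          dist a x = k * dist x b →
          dist (f a) (f x) ≤ η k * dist (f b) (f x) ^ (t ^ 2) := by
  obtain ⟨hJ, ⟨C, hC1, hC⟩, -, x₀, -, hΩeq⟩ := hΩ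
  have hf : f '' sphere (0 : ℂ) 1 = Γ :=
    image_sphere_eq_of_isJordanCurve hJ (hfc.mono sphere_subset_closedBall)
      (hfi.mono sphere_subset_closedBall)
      (image_sphere_subset_of_isTQuasidisk hfc hfi (hfΩ.trans hΩeq))
  choose M hM0 hM using fun n : ℕ =>
    exists_dist_le_mul_rpow_of_le ht ht1 hC1 hC hfc hfd hfi hf (K := max n 1) (le_max_right _ _)
  have hmono : Monotone fun k : ℝ => ∑ i ∈ Finset.range (⌈k⌉₊ + 1), M i := fun k l hkl =>
    Finset.sum_le_sum_of_subset_of_nonneg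
      (Finset.range_mono (Nat.add_le_add_right (Nat.ceil_mono hkl) 1)) fun i _ _ => hM0 i
  refine ⟨fun k => k + ∑ i ∈ Finset.range (⌈k⌉₊ + 1), M i,
    (strictMono_id.add_monotone hmono).strictMonoOn _,
    fun k hk => add_nonneg hk (Finset.sum_nonneg fun i _ => hM0 i), ?_⟩
  intro a ha b hb x hx k hk hd
  refine (hM ⌈k⌉₊ a ha b hb x hx k hk ((Nat.le_ceil k).trans (le_max_left _ _)) hd).trans ?_
  refine mul_le_mul_of_nonneg_right ?_ (by positivity)
  have h1 : M ⌈k⌉₊ ≤ ∑ i ∈ Finset.range (⌈k⌉₊ + 1), M i :=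
    Finset.single_le_sum (f := M) (fun i _ => hM0 i) (Finset.self_mem_range_succ _)
  linarith
end
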